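/- For any recursively enumerable extension T of PA(K), T has (ΣB, Σ₁)-DP if and only if T is ΣB-DC. -/

import Mathlib

namespace ModalArith

/-- Terms of the language of arithmetic L_A = {0, S, +, ×, ≤, =}. -/
inductive Term : Type
  | var : ℕ → Term
  | zero : Term
  | succ : Term → Term
  | add : Term → Term → Term
  | mul : Term → Term → Term
  deriving DecidableEq

namespace Term

/-- Free variables of a term. -/
def fv : Term → Finset ℕ
  | var x => {x}
  | zero => ∅
  | succ t => fv t
  | add t u => fv t ∪ fv u
  | mul t u => fv t ∪ fv u

/-- Simultaneous substitution of terms for variables. -/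
def substAll : Term → (ℕ → Term) → Term
  | var x, v => v x
  | zero, _ => zero
  | succ t, v => succ (substAll t v)
  | add t u, v => add (substAll t v) (substAll u v)
  | mul t u, v => mul (substAll t v) (substAll u v)

/-- Substitution of the term `s` for the variable `x`. -/
def subst (x : ℕ) (s : Term) (t : Term) : Term :=
  substAll t (Function.update Term.var x s)

/-- The numeral `n̄`. -/
def numeral : ℕ → Term
  | 0 => zero
  | n + 1 => succ (numeral n)

/-- Value of a term in the standard model under a valuation. -/
def val : Term → (ℕ → ℕ) → ℕ
  | var x, v => v x
  | zero, _ => 0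
  | succ t, v => val t v + 1
  | add t u, v => val t v + val u v
  | mul t u, v => val t v * val u v

/-- A Gödel numbering of terms. -/
def code : Term → ℕ
  | var x => Nat.pair 0 x
  | zero => Nat.pair 1 0
  | succ t => Nat.pair 2 (code t)
  | add t u => Nat.pair 3 (Nat.pair (code t) (code u))
  | mul t u => Nat.pair 4 (Nat.pair (code t) (code u))

end Term

/-- Formulas of the language L_□ of modal arithmetic. -/
inductive Formula : Type
  | falsum : Formula
  | eq : Term → Term → Formula
  | le : Term → Term → Formula
  | and : Formula → Formula → Formula
  | or : Formula → Formula → Formula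
  | imp : Formula → Formula → Formula
  | neg : Formula → Formula
  | all : ℕ → Formula → Formula
  | ex : ℕ → Formula → Formula
  | box : Formula → Formula
  deriving DecidableEq

namespace Formula

/-- Free variables of a formula. -/
def fv : Formula → Finset ℕ
  | falsum => ∅
  | eq t u => t.fv ∪ u.fv
  | le t u => t.fv ∪ u.fv
  | and φ ψ => fv φ ∪ fv ψ
  | or φ ψ => fv φ ∪ fv ψ
  | imp φ ψ => fv φ ∪ fv ψ
  | neg φ => fv φ
  | all x φ => (fv φ).erase x
  | ex x φ => (fv φ).erase x
  | box φ => fv φ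

/-- Simultaneous substitution of terms for the free variables of a formula. -/
def substAll : Formula → (ℕ → Term) → Formula
  | falsum, _ => falsum
  | eq t u, v => eq (t.substAll v) (u.substAll v)
  | le t u, v => le (t.substAll v) (u.substAll v)
  | and φ ψ, v => and (substAll φ v) (substAll ψ v)
  | or φ ψ, v => or (substAll φ v) (substAll ψ v)
  | imp φ ψ, v => imp (substAll φ v) (substAll ψ v)
  | neg φ, v => neg (substAll φ v)
  | all x φ, v => all x (substAll φ (Function.update v x (Term.var x)))
  | ex x φ, v => ex x (substAll φ (Function.update v x (Term.var x)))
  | box φ, v => box (substAll φ v)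

/-- Substitution of the term `s` for the free occurrences of the variable `x`. -/
def subst (x : ℕ) (s : Term) (φ : Formula) : Formula :=
  substAll φ (Function.update Term.var x s)

/-- The term `s` is substitutable (free) for the variable `x` in the formula. -/
def freeFor (s : Term) (x : ℕ) : Formula → Prop
  | falsum => True
  | eq _ _ => True
  | le _ _ => True
  | and φ ψ => freeFor s x φ ∧ freeFor s x ψ
  | or φ ψ => freeFor s x φ ∧ freeFor s x ψ
  | imp φ ψ => freeFor s x φ ∧ freeFor s x ψ
  | neg φ => freeFor s x φ
  | all y φ => x = y ∨ x ∉ fv φ ∨ (y ∉ s.fv ∧ freeFor s x φ)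
  | ex y φ => x = y ∨ x ∉ fv φ ∨ (y ∉ s.fv ∧ freeFor s x φ)
  | box φ => freeFor s x φ

/-- The formula is an L_A-formula (contains no □). -/
def noBox : Formula → Prop
  | falsum => True
  | eq _ _ => True
  | le _ _ => True
  | and φ ψ => noBox φ ∧ noBox ψ
  | or φ ψ => noBox φ ∧ noBox ψ
  | imp φ ψ => noBox φ ∧ noBox ψ
  | neg φ => noBox φ
  | all _ φ => noBox φ
  | ex _ φ => noBox φ
  | box _ => False

/-- Truth in the standard model ℕ under a valuation (meaningful for L_A-formulas;
boxed formulas are given the dummy value `False`). -/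
def val : Formula → (ℕ → ℕ) → Prop
  | falsum, _ => False
  | eq t u, v => t.val v = u.val v
  | le t u, v => t.val v ≤ u.val v
  | and φ ψ, v => val φ v ∧ val ψ v
  | or φ ψ, v => val φ v ∨ val ψ v
  | imp φ ψ, v => val φ v → val ψ v
  | neg φ, v => ¬ val φ v
  | all x φ, v => ∀ n : ℕ, val φ (Function.update v x n)
  | ex x φ, v => ∃ n : ℕ, val φ (Function.update v x n)
  | box _, _ => False

/-- Biconditional, as an abbreviation. -/
def iff (φ ψ : Formula) : Formula := (φ.imp ψ).and (ψ.imp φ)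

/-- `t < u` abbreviates `S t ≤ u`. -/
def lt (t u : Term) : Formula := le (Term.succ t) u

/-- Bounded universal quantification `∀ x < t, φ`. -/
def ball (x : ℕ) (t : Term) (φ : Formula) : Formula :=
  all x ((lt (Term.var x) t).imp φ)

/-- Bounded existential quantification `∃ x < t, φ`. -/
def bex (x : ℕ) (t : Term) (φ : Formula) : Formula :=
  ex x ((lt (Term.var x) t).and φ)

/-- A Gödel numbering of formulas. -/
def code : Formula → ℕ
  | falsum => Nat.pair 0 0
  | eq t u => Nat.pair 1 (Nat.pair t.code u.code)
  | le t u => Nat.pair 2 (Nat.pair t.code u.code)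
  | and φ ψ => Nat.pair 3 (Nat.pair (code φ) (code ψ))
  | or φ ψ => Nat.pair 4 (Nat.pair (code φ) (code ψ))
  | imp φ ψ => Nat.pair 5 (Nat.pair (code φ) (code ψ))
  | neg φ => Nat.pair 6 (code φ)
  | all x φ => Nat.pair 7 (Nat.pair x (code φ))
  | ex x φ => Nat.pair 8 (Nat.pair x (code φ))
  | box φ => Nat.pair 9 (code φ)

end Formula

/-- A sentence is a formula with no free variables. -/
def Sentence (φ : Formula) : Prop := φ.fv = ∅

/-- Truth in the standard model ℕ (for sentences; any fixed valuation will do). -/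
def StdTrue (φ : Formula) : Prop := φ.val fun _ => 0

/-- The logical axioms of classical first-order logic with equality for L_□,
with the identity axioms only for atomic formulas. -/
inductive LogicalAxiom : Formula → Prop
  | imp1 (φ ψ : Formula) : LogicalAxiom (φ.imp (ψ.imp φ))
  | imp2 (φ ψ χ : Formula) :
      LogicalAxiom ((φ.imp (ψ.imp χ)).imp ((φ.imp ψ).imp (φ.imp χ)))
  | dne (φ : Formula) : LogicalAxiom (φ.neg.neg.imp φ)
  | negI (φ ψ : Formula) : LogicalAxiom ((φ.imp ψ).imp ((φ.imp ψ.neg).imp φ.neg))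
  | negE (φ ψ : Formula) : LogicalAxiom (φ.neg.imp (φ.imp ψ))
  | falsumE (φ : Formula) : LogicalAxiom (Formula.falsum.imp φ)
  | negIntro (φ : Formula) : LogicalAxiom ((φ.imp Formula.falsum).imp φ.neg)
  | negElimFalsum (φ : Formula) : LogicalAxiom (φ.neg.imp (φ.imp Formula.falsum))
  | andI (φ ψ : Formula) : LogicalAxiom (φ.imp (ψ.imp (φ.and ψ)))
  | andE1 (φ ψ : Formula) : LogicalAxiom ((φ.and ψ).imp φ)
  | andE2 (φ ψ : Formula) : LogicalAxiom ((φ.and ψ).imp ψ)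
  | orI1 (φ ψ : Formula) : LogicalAxiom (φ.imp (φ.or ψ))
  | orI2 (φ ψ : Formula) : LogicalAxiom (ψ.imp (φ.or ψ))
  | orE (φ ψ χ : Formula) :
      LogicalAxiom ((φ.imp χ).imp ((ψ.imp χ).imp ((φ.or ψ).imp χ)))
  | allE (x : ℕ) (t : Term) (φ : Formula) :
      φ.freeFor t x → LogicalAxiom ((Formula.all x φ).imp (φ.subst x t))
  | allImp (x : ℕ) (φ ψ : Formula) :
      x ∉ φ.fv → LogicalAxiom ((Formula.all x (φ.imp ψ)).imp (φ.imp (Formula.all x ψ)))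
  | exI (x : ℕ) (t : Term) (φ : Formula) :
      φ.freeFor t x → LogicalAxiom ((φ.subst x t).imp (Formula.ex x φ))
  | exE (x : ℕ) (φ ψ : Formula) :
      x ∉ ψ.fv → LogicalAxiom ((Formula.all x (φ.imp ψ)).imp ((Formula.ex x φ).imp ψ))
  | eqRefl (t : Term) : LogicalAxiom (Formula.eq t t)
  | eqSymm (t u : Term) : LogicalAxiom ((Formula.eq t u).imp (Formula.eq u t))
  | eqTrans (t u w : Term) :
      LogicalAxiom ((Formula.eq t u).imp ((Formula.eq u w).imp (Formula.eq t w)))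
  | eqSucc (t u : Term) :
      LogicalAxiom ((Formula.eq t u).imp (Formula.eq t.succ u.succ))
  | eqAdd (t₁ t₂ u₁ u₂ : Term) :
      LogicalAxiom ((Formula.eq t₁ t₂).imp ((Formula.eq u₁ u₂).imp
        (Formula.eq (t₁.add u₁) (t₂.add u₂))))
  | eqMul (t₁ t₂ u₁ u₂ : Term) :
      LogicalAxiom ((Formula.eq t₁ t₂).imp ((Formula.eq u₁ u₂).imp
        (Formula.eq (t₁.mul u₁) (t₂.mul u₂))))
  | eqLe (t₁ t₂ u₁ u₂ : Term) :
      LogicalAxiom ((Formula.eq t₁ t₂).imp ((Formula.eq u₁ u₂).imp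
        ((Formula.le t₁ u₁).imp (Formula.le t₂ u₂))))

/-- Provability in an L_□-theory: logical axioms, the axioms of the theory, and the
rules modus ponens, generalization, and necessitation. -/
inductive Provable (T : Set Formula) : Formula → Prop
  | ax {φ : Formula} : φ ∈ T → Provable T φ
  | logic {φ : Formula} : LogicalAxiom φ → Provable T φ
  | mp {φ ψ : Formula} : Provable T (φ.imp ψ) → Provable T φ → Provable T ψ
  | gen {φ : Formula} (x : ℕ) : Provable T φ → Provable T (Formula.all x φ)
  | nec {φ : Formula} : Provable T φ → Provable T (Formula.box φ)

/-- First-order provability (no necessitation rule); used for the non-modal theory PA. -/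
inductive FOProvable (T : Set Formula) : Formula → Prop
  | ax {φ : Formula} : φ ∈ T → FOProvable T φ
  | logic {φ : Formula} : LogicalAxiom φ → FOProvable T φ
  | mp {φ ψ : Formula} : FOProvable T (φ.imp ψ) → FOProvable T φ → FOProvable T ψ
  | gen {φ : Formula} (x : ℕ) : FOProvable T φ → FOProvable T (Formula.all x φ)

/-- Basic (Robinson-style) axioms of arithmetic. -/
def succNeZero : Formula := (Formula.eq (Term.succ (Term.var 0)) Term.zero).neg
def succInj : Formula :=
  (Formula.eq (Term.succ (Term.var 0)) (Term.succ (Term.var 1))).imp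
    (Formula.eq (Term.var 0) (Term.var 1))
def addZero : Formula := Formula.eq (Term.add (Term.var 0) Term.zero) (Term.var 0)
def addSucc : Formula :=
  Formula.eq (Term.add (Term.var 0) (Term.succ (Term.var 1)))
    (Term.succ (Term.add (Term.var 0) (Term.var 1)))
def mulZero : Formula := Formula.eq (Term.mul (Term.var 0) Term.zero) Term.zero
def mulSucc : Formula :=
  Formula.eq (Term.mul (Term.var 0) (Term.succ (Term.var 1)))
    (Term.add (Term.mul (Term.var 0) (Term.var 1)) (Term.var 0))
def leDef : Formula :=
  (Formula.le (Term.var 0) (Term.var 1)).iff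
    (Formula.ex 2 (Formula.eq (Term.add (Term.var 0) (Term.var 2)) (Term.var 1)))

def baseAxioms : Set Formula :=
  {succNeZero, succInj, addZero, addSucc, mulZero, mulSucc, leDef}

/-- The induction axiom for the formula `φ` and the variable `x`. -/
def inductionAx (x : ℕ) (φ : Formula) : Formula :=
  ((φ.subst x Term.zero).and
    (Formula.all x (φ.imp (φ.subst x (Term.succ (Term.var x)))))).imp
      (Formula.all x φ)

/-- Peano arithmetic PA: basic axioms plus induction for L_A-formulas. -/
def PA : Set Formula :=
  baseAxioms ∪ {χ | ∃ (x : ℕ) (φ : Formula), φ.noBox ∧ χ = inductionAx x φ}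

/-- PA_□ : basic axioms plus induction for all L_□-formulas. -/
def PABox : Set Formula :=
  baseAxioms ∪ {χ | ∃ (x : ℕ) (φ : Formula), χ = inductionAx x φ}

/-- The distribution axiom K. -/
def axK (φ ψ : Formula) : Formula :=
  (Formula.box (φ.imp ψ)).imp ((Formula.box φ).imp (Formula.box ψ))

/-- PA(K). -/
def PAK : Set Formula := PABox ∪ {χ | ∃ φ ψ : Formula, χ = axK φ ψ}

/-- The axiom 4. -/
def ax4 (φ : Formula) : Formula := (Formula.box φ).imp (Formula.box (Formula.box φ))

/-- PA(K4). -/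
def PAK4 : Set Formula := PAK ∪ {χ | ∃ φ : Formula, χ = ax4 φ}

/-- The axiom of Triv. -/
def axTriv (φ : Formula) : Formula := (Formula.box φ).iff φ

/-- PA(Triv). -/
def PATriv : Set Formula := PAK ∪ {χ | ∃ φ : Formula, χ = axTriv φ}

/-- PA(Ver). -/
def PAVer : Set Formula := PAK ∪ {Formula.box Formula.falsum}

/-- `T` extends `U`: every axiom of `U` is provable in `T`. -/
def Extends (T U : Set Formula) : Prop := ∀ φ ∈ U, Provable T φ

/-- Consistency. -/
def Consistent (T : Set Formula) : Prop := ¬ Provable T Formula.falsum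

/-- The class Δ₀ of bounded L_A-formulas. -/
inductive IsDelta0 : Formula → Prop
  | falsum : IsDelta0 Formula.falsum
  | eq (t u : Term) : IsDelta0 (Formula.eq t u)
  | le (t u : Term) : IsDelta0 (Formula.le t u)
  | and {φ ψ : Formula} : IsDelta0 φ → IsDelta0 ψ → IsDelta0 (φ.and ψ)
  | or {φ ψ : Formula} : IsDelta0 φ → IsDelta0 ψ → IsDelta0 (φ.or ψ)
  | imp {φ ψ : Formula} : IsDelta0 φ → IsDelta0 ψ → IsDelta0 (φ.imp ψ)
  | neg {φ : Formula} : IsDelta0 φ → IsDelta0 φ.neg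
  | ball {x : ℕ} {t : Term} {φ : Formula} :
      x ∉ t.fv → IsDelta0 φ → IsDelta0 (Formula.ball x t φ)
  | bex {x : ℕ} {t : Term} {φ : Formula} :
      x ∉ t.fv → IsDelta0 φ → IsDelta0 (Formula.bex x t φ)

/-- The class Σ₁ of L_A-formulas. -/
inductive IsSigma1 : Formula → Prop
  | delta0 {φ : Formula} : IsDelta0 φ → IsSigma1 φ
  | and {φ ψ : Formula} : IsSigma1 φ → IsSigma1 ψ → IsSigma1 (φ.and ψ)
  | or {φ ψ : Formula} : IsSigma1 φ → IsSigma1 ψ → IsSigma1 (φ.or ψ)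
  | ex {x : ℕ} {φ : Formula} : IsSigma1 φ → IsSigma1 (Formula.ex x φ)
  | ball {x : ℕ} {t : Term} {φ : Formula} :
      x ∉ t.fv → IsSigma1 φ → IsSigma1 (Formula.ball x t φ)

/-- The class B of boxed formulas. -/
def IsB (φ : Formula) : Prop := ∃ ψ : Formula, φ = Formula.box ψ

/-- The class ΔB. -/
inductive IsDeltaB : Formula → Prop
  | delta0 {φ : Formula} : IsDelta0 φ → IsDeltaB φ
  | b (ψ : Formula) : IsDeltaB (Formula.box ψ)
  | and {φ ψ : Formula} : IsDeltaB φ → IsDeltaB ψ → IsDeltaB (φ.and ψ)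
  | or {φ ψ : Formula} : IsDeltaB φ → IsDeltaB ψ → IsDeltaB (φ.or ψ)
  | ball {x : ℕ} {t : Term} {φ : Formula} :
      x ∉ t.fv → IsDeltaB φ → IsDeltaB (Formula.ball x t φ)
  | bex {x : ℕ} {t : Term} {φ : Formula} :
      x ∉ t.fv → IsDeltaB φ → IsDeltaB (Formula.bex x t φ)

/-- The class ΣB. -/
inductive IsSigmaB : Formula → Prop
  | sigma1 {φ : Formula} : IsSigma1 φ → IsSigmaB φ
  | b (ψ : Formula) : IsSigmaB (Formula.box ψ)
  | and {φ ψ : Formula} : IsSigmaB φ → IsSigmaB ψ → IsSigmaB (φ.and ψ)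
  | or {φ ψ : Formula} : IsSigmaB φ → IsSigmaB ψ → IsSigmaB (φ.or ψ)
  | ex {x : ℕ} {φ : Formula} : IsSigmaB φ → IsSigmaB (Formula.ex x φ)
  | ball {x : ℕ} {t : Term} {φ : Formula} :
      x ∉ t.fv → IsSigmaB φ → IsSigmaB (Formula.ball x t φ)

/-- Iterated disjunction (the empty disjunction is ⊥). -/
def disj : List Formula → Formula
  | [] => Formula.falsum
  | [φ] => φ
  | φ :: ψ :: l => φ.or (disj (ψ :: l))

/-- Iterated conjunction (the empty conjunction is ⊤). -/
def conj : List Formula → Formula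
  | [] => Formula.falsum.neg
  | [φ] => φ
  | φ :: ψ :: l => φ.and (conj (ψ :: l))

/-- Γ-disjunction property. -/
def HasDP (T : Set Formula) (Γ : Formula → Prop) : Prop :=
  ∀ φ ψ : Formula, Γ φ → Γ ψ → Sentence φ → Sentence ψ →
    Provable T (φ.or ψ) → Provable T φ ∨ Provable T ψ

/-- (Γ, Θ)-disjunction property. -/
def HasDP2 (T : Set Formula) (Γ Θ : Formula → Prop) : Prop :=
  ∀ φ ψ : Formula, Γ φ → Θ ψ → Sentence φ → Sentence ψ →
    Provable T (φ.or ψ) → Provable T φ ∨ Provable T ψ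

/-- Γ-existence property. -/
def HasEP (T : Set Formula) (Γ : Formula → Prop) : Prop :=
  ∀ (x : ℕ) (φ : Formula), Γ φ → φ.fv ⊆ {x} →
    Provable T (Formula.ex x φ) → ∃ n : ℕ, Provable T (φ.subst x (Term.numeral n))

/-- Modal disjunction property. -/
def HasMDP (T : Set Formula) : Prop :=
  ∀ φ ψ : Formula, Sentence φ → Sentence ψ →
    Provable T ((Formula.box φ).or (Formula.box ψ)) → Provable T φ ∨ Provable T ψ

/-- Modal existence property. -/
def HasMEP (T : Set Formula) : Prop :=
  ∀ (x : ℕ) (φ : Formula), φ.fv ⊆ {x} →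
    Provable T (Formula.ex x (Formula.box φ)) →
      ∃ n : ℕ, Provable T (φ.subst x (Term.numeral n))

/-- n-fold B-disjunction property. -/
def HasBnDP (T : Set Formula) (n : ℕ) : Prop :=
  ∀ φ : Fin n → Formula, (∀ i, Sentence (φ i)) →
    Provable T (disj (List.ofFn fun i => Formula.box (φ i))) →
    ∃ i, Provable T (Formula.box (φ i))

/-- Σ₁-soundness. -/
def Sigma1Sound (T : Set Formula) : Prop :=
  ∀ φ : Formula, IsSigma1 φ → Sentence φ → Provable T φ → StdTrue φ

/-- L_A-soundness. -/
def LASound (T : Set Formula) : Prop :=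
  ∀ φ : Formula, φ.noBox → Sentence φ → Provable T φ → StdTrue φ

/-- `T` is recursively enumerable (via the Gödel numbering of formulas). -/
def RE (T : Set Formula) : Prop :=
  Nat.Partrec fun n => Part.assert (∃ φ ∈ T, Formula.code φ = n) fun _ => Part.some 0

/-- A fixed natural Σ₁ provability predicate `Pr_T(x)` for the theory `T`:
a Σ₁ L_A-formula with only the free variable `0` which numerates provability in `T`
in the standard model and satisfies the standard derivability conditions
(provably in PA). -/
structure ProvPred (T : Set Formula) where
  pr : Formula
  noBox : pr.noBox
  sigma1 : IsSigma1 pr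
  fvSub : pr.fv ⊆ {0}
  numerates : ∀ φ : Formula,
    StdTrue (pr.subst 0 (Term.numeral φ.code)) ↔ Provable T φ
  d1 : ∀ φ : Formula, Provable T φ → FOProvable PA (pr.subst 0 (Term.numeral φ.code))
  d2 : ∀ φ ψ : Formula,
    FOProvable PA ((pr.subst 0 (Term.numeral (φ.imp ψ).code)).imp
      ((pr.subst 0 (Term.numeral φ.code)).imp (pr.subst 0 (Term.numeral ψ.code))))
  necClosed : ∀ φ : Formula,
    FOProvable PA ((pr.subst 0 (Term.numeral φ.code)).imp
      (pr.subst 0 (Term.numeral (Formula.box φ).code)))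

/-- `Pr_T(⌜φ⌝)`. -/
def ProvPred.app {T : Set Formula} (P : ProvPred T) (φ : Formula) : Formula :=
  P.pr.subst 0 (Term.numeral φ.code)

/-- Γ-disjunctive correctness (Γ-DC). -/
def DC (T : Set Formula) (P : ProvPred T) (Γ : Formula → Prop) : Prop :=
  ∀ φ : Formula, Γ φ → Sentence φ → Provable T (φ.or (P.app φ)) → Provable T φ

/-- The substitution replacing each variable by the numeral of its value. -/
def numeralSubst (v : ℕ → ℕ) : ℕ → Term := fun x => Term.numeral (v x)

/-- Standard-model satisfaction of the ρ_T-translation: `ρ_T` is the identity on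
L_A-formulas, commutes with connectives and quantifiers, and sends `□φ(x⃗)` to
`Pr_T(⌜□φ(ẋ⃗)⌝)`, whose truth in ℕ (for a natural provability predicate) amounts to
provability in `T` of `□φ(n̄⃗)`. -/
def RhoSat (T : Set Formula) : Formula → (ℕ → ℕ) → Prop
  | .falsum, _ => False
  | .eq t u, v => t.val v = u.val v
  | .le t u, v => t.val v ≤ u.val v
  | .and φ ψ, v => RhoSat T φ v ∧ RhoSat T ψ v
  | .or φ ψ, v => RhoSat T φ v ∨ RhoSat T ψ v
  | .imp φ ψ, v => RhoSat T φ v → RhoSat T ψ v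
  | .neg φ, v => ¬ RhoSat T φ v
  | .all x φ, v => ∀ n : ℕ, RhoSat T φ (Function.update v x n)
  | .ex x φ, v => ∃ n : ℕ, RhoSat T φ (Function.update v x n)
  | .box φ, v => Provable T (Formula.box (φ.substAll (numeralSubst v)))

/-- Standard-model satisfaction of the π_T-translation: `π_T` is the identity on
L_A-formulas, commutes with connectives and quantifiers, and sends `□φ(x⃗)` to
`Pr_T(⌜φ(ẋ⃗)⌝)`, whose truth in ℕ (for a natural provability predicate) amounts to
provability in `T` of `φ(n̄⃗)`. -/
def PiSat (T : Set Formula) : Formula → (ℕ → ℕ) → Prop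
  | .falsum, _ => False
  | .eq t u, v => t.val v = u.val v
  | .le t u, v => t.val v ≤ u.val v
  | .and φ ψ, v => PiSat T φ v ∧ PiSat T ψ v
  | .or φ ψ, v => PiSat T φ v ∨ PiSat T ψ v
  | .imp φ ψ, v => PiSat T φ v → PiSat T ψ v
  | .neg φ, v => ¬ PiSat T φ v
  | .all x φ, v => ∀ n : ℕ, PiSat T φ (Function.update v x n)
  | .ex x φ, v => ∃ n : ℕ, PiSat T φ (Function.update v x n)
  | .box φ, v => Provable T (φ.substAll (numeralSubst v))

/-- Weak ΣB-soundness: every provable ΣB sentence is true in ℕ under ρ_T. -/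
def WeaklySigmaBSound (T : Set Formula) : Prop :=
  ∀ φ : Formula, IsSigmaB φ → Sentence φ → Provable T φ → RhoSat T φ fun _ => 0

/-- ΣB-soundness: every provable ΣB sentence is true in ℕ under π_T. -/
def SigmaBSound (T : Set Formula) : Prop :=
  ∀ φ : Formula, IsSigmaB φ → Sentence φ → Provable T φ → PiSat T φ fun _ => 0

end ModalArith


namespace ModalArith

open Function

/-! ### Syntactic preliminaries -/

def Term.bnd : Term → ℕ
  | .var x => x + 1
  | .zero => 0
  | .succ t => t.bnd
  | .add t u => max t.bnd u.bnd
  | .mul t u => max t.bnd u.bnd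

def Formula.bnd : Formula → ℕ
  | .falsum => 0
  | .eq t u => max t.bnd u.bnd
  | .le t u => max t.bnd u.bnd
  | .and φ ψ => max φ.bnd ψ.bnd
  | .or φ ψ => max φ.bnd ψ.bnd
  | .imp φ ψ => max φ.bnd ψ.bnd
  | .neg φ => φ.bnd
  | .all x φ => max (x + 1) φ.bnd
  | .ex x φ => max (x + 1) φ.bnd
  | .box φ => φ.bnd

theorem Term.fv_lt (t : Term) : ∀ x ∈ t.fv, x < t.bnd := by
  induction t <;> simp_all [Term.fv, Term.bnd] <;> grind

theorem Formula.fv_lt (φ : Formula) : ∀ x ∈ φ.fv, x < φ.bnd := by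
  induction φ with
  | eq t u => have := t.fv_lt; have := u.fv_lt; simp [Formula.fv, Formula.bnd]; grind
  | le t u => have := t.fv_lt; have := u.fv_lt; simp [Formula.fv, Formula.bnd]; grind
  | _ => simp_all [Formula.fv, Formula.bnd] <;> grind

theorem Term.substAll_congr (t : Term) (s s' : ℕ → Term) (h : ∀ x ∈ t.fv, s x = s' x) :
    t.substAll s = t.substAll s' := by
  induction t <;> simp_all [Term.fv, Term.substAll]

theorem Term.substAll_var (t : Term) : t.substAll Term.var = t := by
  induction t <;> simp_all [Term.substAll]

theorem Formula.substAll_congr (φ : Formula) (s s' : ℕ → Term) (h : ∀ x ∈ φ.fv, s x = s' x) :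
    φ.substAll s = φ.substAll s' := by
  induction φ generalizing s s' with
  | eq t u =>
    simp only [Formula.substAll]
    rw [t.substAll_congr s s' (by simp_all [Formula.fv]), u.substAll_congr s s' (by simp_all [Formula.fv])]
  | le t u =>
    simp only [Formula.substAll]
    rw [t.substAll_congr s s' (by simp_all [Formula.fv]), u.substAll_congr s s' (by simp_all [Formula.fv])]
  | all x φ ih =>
    simp only [Formula.substAll]
    congr 1
    apply ih
    intro y hy
    by_cases hxy : y = x
    · simp [hxy]
    · simp [hxy, h y (by simp [Formula.fv, hxy, hy])]
  | ex x φ ih =>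
    simp only [Formula.substAll]
    congr 1
    apply ih
    intro y hy
    by_cases hxy : y = x
    · simp [hxy]
    · simp [hxy, h y (by simp [Formula.fv, hxy, hy])]
  | falsum => rfl
  | and φ ψ ih1 ih2 =>
    simp only [Formula.substAll]
    rw [ih1 s s' (by simp_all [Formula.fv]), ih2 s s' (by simp_all [Formula.fv])]
  | or φ ψ ih1 ih2 =>
    simp only [Formula.substAll]
    rw [ih1 s s' (by simp_all [Formula.fv]), ih2 s s' (by simp_all [Formula.fv])]
  | imp φ ψ ih1 ih2 =>
    simp only [Formula.substAll]
    rw [ih1 s s' (by simp_all [Formula.fv]), ih2 s s' (by simp_all [Formula.fv])]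
  | neg φ ih => simp only [Formula.substAll]; rw [ih s s' (by simp_all [Formula.fv])]
  | box φ ih => simp only [Formula.substAll]; rw [ih s s' (by simp_all [Formula.fv])]

theorem update_var_self (x : ℕ) : Function.update Term.var x (Term.var x) = Term.var :=
  Function.update_eq_self x Term.var

theorem Formula.substAll_var (φ : Formula) : φ.substAll Term.var = φ := by
  induction φ <;> simp_all [Formula.substAll, Term.substAll_var]

theorem Formula.subst_self (φ : Formula) (x : ℕ) : φ.subst x (Term.var x) = φ := by
  rw [Formula.subst, update_var_self, Formula.substAll_var]

theorem Formula.subst_of_notMem (φ : Formula) (x : ℕ) (t : Term) (h : x ∉ φ.fv) :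
    φ.subst x t = φ := by
  conv_rhs => rw [← φ.substAll_var]
  apply Formula.substAll_congr
  intro y hy
  have : y ≠ x := by rintro rfl; exact h hy
  simp [this]

theorem Formula.substAll_sentence (φ : Formula) (h : φ.fv = ∅) (s : ℕ → Term) :
    φ.substAll s = φ := by
  conv_rhs => rw [← φ.substAll_var]
  apply Formula.substAll_congr
  simp [h]

theorem Formula.freeFor_self (φ : Formula) (x : ℕ) : φ.freeFor (Term.var x) x := by
  induction φ <;> simp_all [Formula.freeFor, Term.fv] <;> grind

theorem Formula.freeFor_succ_self (φ : Formula) (x : ℕ) :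
    φ.freeFor (Term.succ (Term.var x)) x := by
  induction φ <;> simp_all [Formula.freeFor, Term.fv] <;> grind

theorem Formula.freeFor_closed (φ : Formula) (x : ℕ) (t : Term) (ht : t.fv = ∅) :
    φ.freeFor t x := by
  induction φ <;> simp_all [Formula.freeFor]

theorem Term.fv_numeral (n : ℕ) : (Term.numeral n).fv = ∅ := by
  induction n <;> simp_all [Term.numeral, Term.fv]

theorem Term.substAll_comp (t : Term) (s s' : ℕ → Term) :
    (t.substAll s).substAll s' = t.substAll (fun i => (s i).substAll s') := by
  induction t <;> simp_all [Term.substAll]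

theorem Formula.freeFor_high (N : ℕ) (φ : Formula) (hφ : φ.bnd ≤ N) (t : Term)
    (ht : ∀ y ∈ t.fv, N ≤ y) (x : ℕ) (s : ℕ → Term) : (φ.substAll s).freeFor t x := by
  induction φ generalizing s with
  | all y φ ih =>
    simp only [Formula.bnd, sup_le_iff] at hφ
    exact Or.inr (Or.inr ⟨fun h => by have := ht y h; omega, ih hφ.2 _⟩)
  | ex y φ ih =>
    simp only [Formula.bnd, sup_le_iff] at hφ
    exact Or.inr (Or.inr ⟨fun h => by have := ht y h; omega, ih hφ.2 _⟩)
  | _ => simp_all [Formula.bnd, Formula.substAll, Formula.freeFor]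

theorem upd_comp (N : ℕ) (s s' : ℕ → Term) (x : ℕ) (hx : x < N)
    (h : ∀ y < N, ∀ i, i ≠ y → y ∈ (s i).fv → s' y = Term.var y) :
    (fun i => (update s x (Term.var x) i).substAll (update s' x (Term.var x))) =
      update (fun i => (s i).substAll s') x (Term.var x) := by
  funext i
  by_cases hi : i = x
  · subst hi; simp [Term.substAll]
  · simp only [ne_eq, hi, not_false_eq_true, update_of_ne]
    apply Term.substAll_congr
    intro z hz
    by_cases hzx : z = x
    · subst hzx; simp [h z hx i hi hz]
    · simp [hzx]

theorem Formula.substAll_comp (N : ℕ) (φ : Formula) (hφ : φ.bnd ≤ N) (s s' : ℕ → Term)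
    (h : ∀ y < N, ∀ i, i ≠ y → y ∈ (s i).fv → s' y = Term.var y) :
    (φ.substAll s).substAll s' = φ.substAll (fun i => (s i).substAll s') := by
  have key : ∀ (x : ℕ) (s s' : ℕ → Term),
      (∀ y < N, ∀ i, i ≠ y → y ∈ (s i).fv → s' y = Term.var y) →
      (∀ y < N, ∀ i, i ≠ y → y ∈ (update s x (Term.var x) i).fv →
        update s' x (Term.var x) y = Term.var y) := by
    intro x s s' h y hy i hi hm
    by_cases hix : i = x
    · subst hix; simp [Term.fv] at hm; exact absurd hm.symm hi
    · simp only [ne_eq, hix, not_false_eq_true, update_of_ne] at hm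
      by_cases hyx : y = x
      · subst hyx; simp
      · simp [hyx, h y hy i hi hm]
  induction φ generalizing s s' with
  | all x φ ih =>
    simp only [Formula.bnd, sup_le_iff] at hφ
    simp only [Formula.substAll]
    rw [ih hφ.2 _ _ (key x s s' h), upd_comp N s s' x (by omega) h]
  | ex x φ ih =>
    simp only [Formula.bnd, sup_le_iff] at hφ
    simp only [Formula.substAll]
    rw [ih hφ.2 _ _ (key x s s' h), upd_comp N s s' x (by omega) h]
  | eq t u => simp [Formula.substAll, Term.substAll_comp]
  | le t u => simp [Formula.substAll, Term.substAll_comp]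
  | falsum => rfl
  | neg φ ih => simp only [Formula.substAll]; rw [ih hφ s s' h]
  | box φ ih => simp only [Formula.substAll]; rw [ih hφ s s' h]
  | and φ ψ ih1 ih2 =>
    simp only [Formula.bnd, sup_le_iff] at hφ
    simp only [Formula.substAll]; rw [ih1 hφ.1 s s' h, ih2 hφ.2 s s' h]
  | or φ ψ ih1 ih2 =>
    simp only [Formula.bnd, sup_le_iff] at hφ
    simp only [Formula.substAll]; rw [ih1 hφ.1 s s' h, ih2 hφ.2 s s' h]
  | imp φ ψ ih1 ih2 =>
    simp only [Formula.bnd, sup_le_iff] at hφ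
    simp only [Formula.substAll]; rw [ih1 hφ.1 s s' h, ih2 hφ.2 s s' h]

theorem Formula.subst_back (φ : Formula) (x y : ℕ) (hy : φ.bnd ≤ y) :
    (φ.subst x (Term.var y)).subst y (Term.var x) = φ := by
  have h := Formula.substAll_comp y φ hy (update Term.var x (Term.var y))
    (update Term.var y (Term.var x)) (by
      intro z hz i hi hm
      have : z ≠ y := by omega
      simp [this])
  rw [Formula.subst, Formula.subst, h]
  conv_rhs => rw [← φ.substAll_var]
  apply Formula.substAll_congr
  intro i hi
  have := φ.fv_lt i hi
  by_cases hix : i = x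
  · subst hix; simp [Term.substAll]
  · simp [Term.substAll, hix, show i ≠ y by omega]

theorem Formula.fv_of_bnd (φ : Formula) (y : ℕ) (hy : φ.bnd ≤ y) : y ∉ φ.fv := fun h => by
  have := φ.fv_lt y h; omega

theorem Formula.freeFor_back (φ : Formula) (x y : ℕ) (hy : φ.bnd ≤ y) (hxy : x ≠ y) :
    ∀ s : ℕ → Term, (∀ z, z ≠ x → z < y → s z = Term.var z) →
      (s x = Term.var y ∨ s x = Term.var x) → (φ.substAll s).freeFor (Term.var x) y := by
  have aux : ∀ (φ : Formula) (s : ℕ → Term), φ.bnd ≤ y →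
      (∀ z, z < y → s z = Term.var z) → φ.substAll s = φ := by
    intro φ s hb hs
    conv_rhs => rw [← φ.substAll_var]
    apply Formula.substAll_congr
    intro i hi
    have := φ.fv_lt i hi
    exact hs i (by omega)
  induction φ with
  | all z φ ih =>
    simp only [Formula.bnd, sup_le_iff] at hy
    intro s hs hx
    simp only [Formula.substAll, Formula.freeFor]
    by_cases hzx : z = x
    · subst hzx
      right; left
      rw [aux φ _ hy.2]
      · exact φ.fv_of_bnd y hy.2
      · intro w hw
        by_cases hwz : w = z
        · subst hwz; simp
        · simp [hwz, hs w hwz hw]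
    · right; right
      refine ⟨by simp [Term.fv, hzx], ih hy.2 _ ?_ ?_⟩
      · intro w hw1 hw2
        by_cases hwz : w = z
        · subst hwz; simp
        · simp [hwz, hs w hw1 hw2]
      · simpa [update_of_ne (Ne.symm hzx)] using hx
  | ex z φ ih =>
    simp only [Formula.bnd, sup_le_iff] at hy
    intro s hs hx
    simp only [Formula.substAll, Formula.freeFor]
    by_cases hzx : z = x
    · subst hzx
      right; left
      rw [aux φ _ hy.2]
      · exact φ.fv_of_bnd y hy.2
      · intro w hw
        by_cases hwz : w = z
        · subst hwz; simp
        · simp [hwz, hs w hwz hw]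
    · right; right
      refine ⟨by simp [Term.fv, hzx], ih hy.2 _ ?_ ?_⟩
      · intro w hw1 hw2
        by_cases hwz : w = z
        · subst hwz; simp
        · simp [hwz, hs w hw1 hw2]
      · simpa [update_of_ne (Ne.symm hzx)] using hx
  | _ =>
    intro s hs hx
    simp_all [Formula.bnd, Formula.substAll, Formula.freeFor]

/-! fv of substitution: the substituted variable disappears. -/

theorem Term.fv_substAll (t : Term) (s : ℕ → Term) :
    ∀ y ∈ (t.substAll s).fv, ∃ x ∈ t.fv, y ∈ (s x).fv := by
  induction t <;> simp_all [Term.substAll, Term.fv] <;> grind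

theorem Formula.fv_substAll (φ : Formula) (s : ℕ → Term) :
    ∀ y ∈ (φ.substAll s).fv, ∃ x ∈ φ.fv, y ∈ (s x).fv := by
  induction φ generalizing s with
  | falsum => simp [Formula.substAll, Formula.fv]
  | eq t u =>
    have h1 := t.fv_substAll s; have h2 := u.fv_substAll s
    simp [Formula.substAll, Formula.fv]; grind
  | le t u =>
    have h1 := t.fv_substAll s; have h2 := u.fv_substAll s
    simp [Formula.substAll, Formula.fv]; grind
  | all x φ ih =>
    intro y hy
    simp only [Formula.substAll, Formula.fv, Finset.mem_erase] at hy
    obtain ⟨z, hz, hyz⟩ := ih _ y hy.2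
    by_cases hzx : z = x
    · subst hzx; simp [Term.fv] at hyz; exact absurd hyz hy.1
    · exact ⟨z, by simp [Formula.fv, hzx, hz], by simpa [hzx] using hyz⟩
  | ex x φ ih =>
    intro y hy
    simp only [Formula.substAll, Formula.fv, Finset.mem_erase] at hy
    obtain ⟨z, hz, hyz⟩ := ih _ y hy.2
    by_cases hzx : z = x
    · subst hzx; simp [Term.fv] at hyz; exact absurd hyz hy.1
    · exact ⟨z, by simp [Formula.fv, hzx, hz], by simpa [hzx] using hyz⟩
  | neg φ ih => simpa [Formula.substAll, Formula.fv] using ih s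
  | box φ ih => simpa [Formula.substAll, Formula.fv] using ih s
  | and φ ψ ih1 ih2 =>
    have h1 := ih1 s; have h2 := ih2 s
    simp [Formula.substAll, Formula.fv]; grind
  | or φ ψ ih1 ih2 =>
    have h1 := ih1 s; have h2 := ih2 s
    simp [Formula.substAll, Formula.fv]; grind
  | imp φ ψ ih1 ih2 =>
    have h1 := ih1 s; have h2 := ih2 s
    simp [Formula.substAll, Formula.fv]; grind

/-! ### Countability -/

theorem Term.code_inj : ∀ t u : Term, t.code = u.code → t = u := by
  intro t
  induction t <;> intro u h <;> cases u <;>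
    simp_all [Term.code, Nat.pair_eq_pair] <;> grind

theorem Formula.code_inj : ∀ φ ψ : Formula, φ.code = ψ.code → φ = ψ := by
  intro t
  induction t <;> intro u h <;> cases u <;>
    simp_all [Formula.code, Nat.pair_eq_pair] <;> grind [Term.code_inj]

instance : Countable Formula := ⟨⟨Formula.code, fun φ ψ h => Formula.code_inj φ ψ h⟩⟩

end ModalArith


namespace ModalArith

open Function

/-! ### Derivations from hypotheses -/

inductive Der (T : Set Formula) (Γ : Set Formula) : Formula → Prop
  | hyp {φ : Formula} : φ ∈ Γ → Der T Γ φ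
  | thm {φ : Formula} : Provable T φ → Der T Γ φ
  | mp {φ ψ : Formula} : Der T Γ (φ.imp ψ) → Der T Γ φ → Der T Γ ψ

variable {T : Set Formula}

theorem Der.lg {Γ : Set Formula} {φ : Formula} (h : LogicalAxiom φ) : Der T Γ φ :=
  .thm (.logic h)

theorem Der.mono {Γ Δ : Set Formula} (h : Γ ⊆ Δ) {φ : Formula} (d : Der T Γ φ) : Der T Δ φ := by
  induction d with
  | hyp h' => exact .hyp (h h')
  | thm h' => exact .thm h'
  | mp _ _ ih1 ih2 => exact .mp ih1 ih2

theorem Der.toProv {φ : Formula} (d : Der T ∅ φ) : Provable T φ := by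
  induction d with
  | hyp h' => exact h'.elim
  | thm h' => exact h'
  | mp _ _ ih1 ih2 => exact .mp ih1 ih2

theorem Der.id {Γ : Set Formula} (φ : Formula) : Der T Γ (φ.imp φ) :=
  .mp (.mp (.lg (.imp2 φ (φ.imp φ) φ)) (.lg (.imp1 _ _))) (.lg (.imp1 _ _))

theorem Der.ded {Γ : Set Formula} {φ ψ : Formula} (d : Der T (insert φ Γ) ψ) :
    Der T Γ (φ.imp ψ) := by
  induction d with
  | hyp h' =>
    rcases h' with rfl | h'
    · exact .id _
    · exact .mp (.lg (.imp1 _ _)) (.hyp h')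
  | thm h' => exact .mp (.lg (.imp1 _ _)) (.thm h')
  | mp _ _ ih1 ih2 => exact .mp (.mp (.lg (.imp2 _ _ _)) ih1) ih2

theorem Der.weak {Γ : Set Formula} {φ ψ : Formula} (d : Der T Γ ψ) : Der T (insert φ Γ) ψ :=
  d.mono (Set.subset_insert _ _)

theorem Der.h0 {Γ : Set Formula} {φ : Formula} : Der T (insert φ Γ) φ :=
  .hyp (Set.mem_insert _ _)

theorem prov_imp_trans {φ ψ χ : Formula} (h1 : Provable T (φ.imp ψ)) (h2 : Provable T (ψ.imp χ)) :
    Provable T (φ.imp χ) :=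
  Der.toProv (Der.ded (.mp (.thm h2) (.mp (.thm h1) .h0)))

theorem prov_all_imp {x : ℕ} {φ ψ : Formula} (hx : x ∉ φ.fv) (h : Provable T (φ.imp ψ)) :
    Provable T (φ.imp (.all x ψ)) :=
  .mp (.logic (.allImp x φ ψ hx)) (.gen x h)

theorem prov_all_elim (x : ℕ) (φ : Formula) : Provable T ((Formula.all x φ).imp φ) := by
  have := LogicalAxiom.allE x (Term.var x) φ (φ.freeFor_self x)
  rw [φ.subst_self] at this
  exact .logic this

theorem prov_all_dist (x : ℕ) (φ ψ : Formula) :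
    Provable T ((Formula.all x (φ.imp ψ)).imp ((Formula.all x φ).imp (.all x ψ))) := by
  have h : Provable T (((Formula.all x (φ.imp ψ)).and (.all x φ)).imp ψ) := by
    apply Der.toProv
    apply Der.ded
    exact .mp (.mp (.thm (prov_all_elim x _)) (.mp (.lg (.andE1 _ _)) .h0))
      (.mp (.thm (prov_all_elim x _)) (.mp (.lg (.andE2 _ _)) .h0))
  have h2 := prov_all_imp (x := x) (by simp [Formula.fv]) h
  apply Der.toProv
  apply Der.ded
  apply Der.ded
  exact .mp (.thm h2) (.mp (.mp (.lg (.andI _ _)) (.weak .h0)) .h0)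

theorem Der.gen {Γ : Set Formula} {φ : Formula} (y : ℕ) (hy : ∀ ψ ∈ Γ, y ∉ ψ.fv)
    (d : Der T Γ φ) : Der T Γ (.all y φ) := by
  induction d with
  | hyp h' => exact .mp (.thm (prov_all_imp (hy _ h') (Der.toProv (.id _)))) (.hyp h')
  | thm h' => exact .thm (.gen y h')
  | mp _ _ ih1 ih2 => exact .mp (.mp (.thm (prov_all_dist _ _ _)) ih1) ih2

theorem Der.neg_intro {Γ : Set Formula} {φ : Formula} (d : Der T (insert φ Γ) .falsum) :
    Der T Γ φ.neg := .mp (.lg (.negIntro _)) d.ded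

theorem Der.neg_elim {Γ : Set Formula} {φ ψ : Formula} (h1 : Der T Γ φ.neg) (h2 : Der T Γ φ) :
    Der T Γ ψ := .mp (.mp (.lg (.negE _ _)) h1) h2

theorem Der.by_contra {Γ : Set Formula} {φ : Formula} (d : Der T (insert φ.neg Γ) .falsum) :
    Der T Γ φ := .mp (.lg (.dne _)) d.neg_intro

/-- Alpha-renaming for a totally fresh variable. -/
theorem prov_alpha (φ : Formula) (x y : ℕ) (hy : φ.bnd ≤ y) (hxy : x ≠ y) :
    Provable T ((Formula.all y (φ.subst x (Term.var y))).imp (.all x φ)) := by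
  apply prov_all_imp
  · simp only [Formula.fv, Finset.mem_erase, not_and]
    intro _ hm
    obtain ⟨z, hz, hm⟩ := Formula.fv_substAll _ _ _ hm
    by_cases hzx : z = x
    · subst hzx; simp [Term.fv] at hm; exact hxy hm
    · simp [hzx, Term.fv] at hm; exact hzx hm.symm
  · have := LogicalAxiom.allE y (Term.var x) (φ.subst x (Term.var y))
      (φ.freeFor_back x y hy hxy _ (by intro z hz _; simp [hz]) (by simp))
    rw [φ.subst_back x y hy] at this
    exact .logic this

def wit (x : ℕ) (φ : Formula) (y : ℕ) : Formula := (φ.subst x (Term.var y)).imp (.all x φ)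

theorem wit_consistent {Γ : Set Formula} (x : ℕ) (φ : Formula) (y : ℕ) (hy : φ.bnd ≤ y)
    (hxy : x ≠ y) (hΓ : ∀ ψ ∈ Γ, y ∉ ψ.fv) (d : Der T (insert (wit x φ y) Γ) .falsum) :
    Der T Γ .falsum := by
  have hn : Der T Γ (wit x φ y).neg := d.neg_intro
  have h1 : Der T Γ (φ.subst x (Term.var y)) := by
    apply Der.by_contra
    refine Der.neg_elim (.weak hn) (Der.ded ?_)
    exact Der.neg_elim (.weak .h0) .h0
  have h2 : Der T Γ (.all x φ) := .mp (.thm (prov_alpha φ x y hy hxy)) (h1.gen y hΓ)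
  exact Der.neg_elim hn (Der.ded h2.weak)

theorem der_sUnion {c : Set (Set Formula)} (hc : IsChain (· ⊆ ·) c) (hne : c.Nonempty)
    {φ : Formula} (d : Der T (⋃₀ c) φ) : ∃ s ∈ c, Der T s φ := by
  induction d with
  | hyp h' => obtain ⟨s, hs, h⟩ := h'; exact ⟨s, hs, .hyp h⟩
  | thm h' => obtain ⟨s, hs⟩ := hne; exact ⟨s, hs, .thm h'⟩
  | mp _ _ ih1 ih2 =>
    obtain ⟨s, hs, h1⟩ := ih1
    obtain ⟨s', hs', h2⟩ := ih2
    rcases hc.total hs hs' with h | h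
    · exact ⟨s', hs', .mp (h1.mono h) h2⟩
    · exact ⟨s, hs, .mp h1 (h2.mono h)⟩

/-- Existence of maximal consistent Henkin sets. -/
theorem exists_henkin (N : ℕ) (χ : Formula) (hχ : ¬ Provable T χ) :
    ∃ Δ : Set Formula, χ.neg ∈ Δ ∧ ¬ Der T Δ .falsum ∧
      (∀ φ, φ ∈ Δ ∨ φ.neg ∈ Δ) ∧
      (∀ x φ, ∃ y, N ≤ y ∧ wit x φ y ∈ Δ) := by
  have : Nonempty (ℕ × Formula) := ⟨(0, .falsum)⟩
  obtain ⟨e, he⟩ := exists_surjective_nat (ℕ × Formula)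
  let fr : ℕ → Formula → Finset Formula → ℕ := fun x φ G => N + φ.bnd + (x + 1) + G.sup Formula.bnd
  obtain ⟨Γ, hz, hs⟩ : ∃ Γ : ℕ → Finset Formula, Γ 0 = {χ.neg} ∧ ∀ n, Γ (n + 1) =
      insert (wit (e n).1 (e n).2 (fr (e n).1 (e n).2 (Γ n))) (Γ n) :=
    ⟨fun n => Nat.rec {χ.neg}
      (fun n G => insert (wit (e n).1 (e n).2 (fr (e n).1 (e n).2 G)) G) n, rfl, fun _ => rfl⟩
  have hcons : ∀ n, ¬ Der T (↑(Γ n) : Set Formula) .falsum := by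
    intro n
    induction n with
    | zero =>
      intro d
      apply hχ
      apply Der.toProv
      apply Der.by_contra
      refine d.mono ?_
      simp [hz]
    | succ n ih =>
      intro d
      apply ih
      rw [hs, Finset.coe_insert] at d
      refine wit_consistent _ _ _ ?_ ?_ ?_ d
      · simp only [fr]; omega
      · simp only [fr]; omega
      · intro ψ hψ
        apply Formula.fv_of_bnd
        have : ψ.bnd ≤ (Γ n).sup Formula.bnd := Finset.le_sup (f := Formula.bnd) hψ
        simp only [fr]; omega
  have hmono : Monotone (fun n => (↑(Γ n) : Set Formula)) := by
    apply monotone_nat_of_le_succ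
    intro n
    rw [hs]
    simp
  let c : Set (Set Formula) := Set.range (fun n => (↑(Γ n) : Set Formula))
  have hU : ¬ Der T (⋃₀ c) .falsum := by
    intro d
    have hch : IsChain (· ⊆ ·) c := by
      rintro _ ⟨n, rfl⟩ _ ⟨m, rfl⟩ _
      rcases le_total n m with h | h
      · exact Or.inl (hmono h)
      · exact Or.inr (hmono h)
    obtain ⟨s, ⟨n, rfl⟩, h⟩ := der_sUnion hch ⟨_, ⟨0, rfl⟩⟩ d
    exact hcons n h
  obtain ⟨Δ, hsub, hmax⟩ := zorn_subset_nonempty {Δ : Set Formula | ¬ Der T Δ .falsum} (by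
    intro c hc hch hne
    refine ⟨⋃₀ c, ?_, fun s hs => Set.subset_sUnion_of_mem hs⟩
    intro d
    obtain ⟨s, hs, h⟩ := der_sUnion hch hne d
    exact hc hs h) (⋃₀ c) hU
  refine ⟨Δ, ?_, hmax.prop, ?_, ?_⟩
  · exact hsub ⟨_, ⟨0, rfl⟩, by simp [hz]⟩
  · intro φ
    by_contra! hcon
    obtain ⟨h1, h2⟩ := hcon
    have k : ∀ ψ, ψ ∉ Δ → Der T (insert ψ Δ) .falsum := by
      intro ψ hψ
      by_contra hd
      exact hψ (hmax.le_of_ge (y := insert ψ Δ) hd (Set.subset_insert _ _) (Set.mem_insert _ _))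
    exact hmax.prop (Der.neg_elim (k _ h2).neg_intro (k _ h1).neg_intro)
  · intro x φ
    obtain ⟨n, hn⟩ := he (x, φ)
    refine ⟨fr x φ (Γ n), by simp only [fr]; omega, hsub ⟨_, ⟨n + 1, rfl⟩, ?_⟩⟩
    simp only [hs, hn]
    simp

/-! ### Structures -/

class Ar (M : Type) where
  zero : M
  succ : M → M
  add : M → M → M
  mul : M → M → M
  le : M → M → Prop

def Term.mval {M : Type} [Ar M] : Term → (ℕ → M) → M
  | .var x, v => v x
  | .zero, _ => Ar.zero
  | .succ t, v => Ar.succ (t.mval v)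
  | .add t u, v => Ar.add (t.mval v) (u.mval v)
  | .mul t u, v => Ar.mul (t.mval v) (u.mval v)

def Formula.mval {M : Type} [Ar M] : Formula → (ℕ → M) → Prop
  | .falsum, _ => False
  | .eq t u, v => t.mval v = u.mval v
  | .le t u, v => Ar.le (t.mval v) (u.mval v)
  | .and φ ψ, v => φ.mval v ∧ ψ.mval v
  | .or φ ψ, v => φ.mval v ∨ ψ.mval v
  | .imp φ ψ, v => φ.mval v → ψ.mval v
  | .neg φ, v => ¬ φ.mval v
  | .all x φ, v => ∀ n : M, φ.mval (Function.update v x n)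
  | .ex x φ, v => ∃ n : M, φ.mval (Function.update v x n)
  | .box _, _ => False

theorem Term.mval_congr {M : Type} [Ar M] (t : Term) (v w : ℕ → M) (h : ∀ x ∈ t.fv, v x = w x) :
    t.mval v = t.mval w := by
  induction t <;> simp_all [Term.fv, Term.mval]

theorem upd_agree {M : Type} {S : Finset ℕ} {v w : ℕ → M} {x : ℕ} (m : M)
    (h : ∀ y ∈ S.erase x, v y = w y) : ∀ y ∈ S, update v x m y = update w x m y := by
  intro y hy
  by_cases hyx : y = x
  · subst hyx; simp
  · simp [hyx, h y (by simp [hyx, hy])]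

theorem Formula.mval_congr {M : Type} [Ar M] (φ : Formula) (v w : ℕ → M)
    (h : ∀ x ∈ φ.fv, v x = w x) : φ.mval v ↔ φ.mval w := by
  induction φ generalizing v w with
  | falsum => rfl
  | box => rfl
  | eq t u =>
    simp only [Formula.mval]
    rw [t.mval_congr v w (by simp_all [Formula.fv]), u.mval_congr v w (by simp_all [Formula.fv])]
  | le t u =>
    simp only [Formula.mval]
    rw [t.mval_congr v w (by simp_all [Formula.fv]), u.mval_congr v w (by simp_all [Formula.fv])]
  | all x φ ih =>
    simp only [Formula.mval]
    exact forall_congr' fun m => ih _ _ (upd_agree m h)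
  | ex x φ ih =>
    simp only [Formula.mval]
    exact exists_congr fun m => ih _ _ (upd_agree m h)
  | neg φ ih => simp only [Formula.mval]; rw [ih v w (by simp_all [Formula.fv])]
  | and φ ψ ih1 ih2 =>
    simp only [Formula.mval]
    rw [ih1 v w (by simp_all [Formula.fv]), ih2 v w (by simp_all [Formula.fv])]
  | or φ ψ ih1 ih2 =>
    simp only [Formula.mval]
    rw [ih1 v w (by simp_all [Formula.fv]), ih2 v w (by simp_all [Formula.fv])]
  | imp φ ψ ih1 ih2 =>
    simp only [Formula.mval]
    rw [ih1 v w (by simp_all [Formula.fv]), ih2 v w (by simp_all [Formula.fv])]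

theorem Term.mval_substAll {M : Type} [Ar M] (t : Term) (s : ℕ → Term) (v : ℕ → M) :
    (t.substAll s).mval v = t.mval (fun i => (s i).mval v) := by
  induction t <;> simp_all [Term.substAll, Term.mval]

theorem upd_mval {M : Type} [Ar M] (x : ℕ) (t : Term) (v : ℕ → M) :
    (fun i => (update Term.var x t i).mval v) = update v x (t.mval v) := by
  funext i
  by_cases hi : i = x
  · subst hi; simp
  · simp [hi, Term.mval]

theorem Formula.mval_subst_q {M : Type} [Ar M] {x y : ℕ} {t : Term} {φ : Formula}
    (h : x = y ∨ x ∉ φ.fv ∨ (y ∉ t.fv ∧ φ.freeFor t x))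
    (ih : ∀ v : ℕ → M, φ.freeFor t x → ((φ.subst x t).mval v ↔ φ.mval (update v x (t.mval v))))
    (v : ℕ → M) (m : M) :
    (φ.substAll (update (update Term.var x t) y (Term.var y))).mval (update v y m) ↔
      φ.mval (update (update v x (t.mval v)) y m) := by
  by_cases hxy : x = y
  · subst hxy
    simp [Formula.substAll_var]
  rcases h with h | h | ⟨h1, h2⟩
  · exact absurd h hxy
  · have : φ.substAll (update (update Term.var x t) y (Term.var y)) = φ := by
      conv_rhs => rw [← φ.substAll_var]
      apply Formula.substAll_congr
      intro i hi
      have hix : i ≠ x := by rintro rfl; exact h hi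
      by_cases hiy : i = y
      · subst hiy; simp
      · simp [hiy, hix]
    rw [this]
    apply Formula.mval_congr
    intro i hi
    have hix : i ≠ x := by rintro rfl; exact h hi
    by_cases hiy : i = y
    · subst hiy; simp
    · simp [hiy, hix]
  · have h3 : update (update Term.var x t) y (Term.var y) = update Term.var x t := by
      rw [update_comm hxy, update_var_self]
    rw [h3]
    have := ih (update v y m) h2
    rw [Formula.subst] at this
    rw [this, update_comm hxy, t.mval_congr (update v y m) v]
    intro i hi
    have : i ≠ y := by rintro rfl; exact h1 hi
    simp [this]

theorem Formula.mval_subst {M : Type} [Ar M] (x : ℕ) (t : Term) (φ : Formula) (v : ℕ → M)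
    (h : φ.freeFor t x) : (φ.subst x t).mval v ↔ φ.mval (update v x (t.mval v)) := by
  induction φ generalizing v with
  | falsum => rfl
  | box => rfl
  | eq a b =>
    simp only [Formula.subst, Formula.substAll, Formula.mval, Term.mval_substAll, upd_mval]
  | le a b =>
    simp only [Formula.subst, Formula.substAll, Formula.mval, Term.mval_substAll, upd_mval]
  | all y φ ih =>
    simp only [Formula.subst, Formula.substAll, Formula.mval]
    exact forall_congr' fun m => Formula.mval_subst_q h ih v m
  | ex y φ ih =>
    simp only [Formula.subst, Formula.substAll, Formula.mval]
    exact exists_congr fun m => Formula.mval_subst_q h ih v m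
  | neg φ ih => exact not_congr (ih v h)
  | and φ ψ ih1 ih2 => exact and_congr (ih1 v h.1) (ih2 v h.2)
  | or φ ψ ih1 ih2 => exact or_congr (ih1 v h.1) (ih2 v h.2)
  | imp φ ψ ih1 ih2 => exact imp_congr (ih1 v h.1) (ih2 v h.2)

/-- Models of arithmetic with induction for box-free formulas with all variables `< N`. -/
structure IsMdl (N : ℕ) (M : Type) [Ar M] : Prop where
  succ_ne : ∀ a : M, Ar.succ a ≠ Ar.zero
  succ_inj : ∀ a b : M, Ar.succ a = Ar.succ b → a = b
  add_zero : ∀ a : M, Ar.add a Ar.zero = a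
  add_succ : ∀ a b : M, Ar.add a (Ar.succ b) = Ar.succ (Ar.add a b)
  mul_zero : ∀ a : M, Ar.mul a Ar.zero = Ar.zero
  mul_succ : ∀ a b : M, Ar.mul a (Ar.succ b) = Ar.add (Ar.mul a b) a
  le_def : ∀ a b : M, Ar.le a b ↔ ∃ c, Ar.add a c = b
  ind : ∀ (φ : Formula), φ.noBox → φ.bnd ≤ N → ∀ x < N, ∀ v : ℕ → M,
    φ.mval (update v x Ar.zero) →
    (∀ a : M, φ.mval (update v x a) → φ.mval (update v x (Ar.succ a))) →
    ∀ a : M, φ.mval (update v x a)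

end ModalArith


namespace ModalArith

open Function

variable {T : Set Formula}

/-- Maximal consistent Henkin sets. -/
structure Hk (T : Set Formula) (N : ℕ) (Δ : Set Formula) : Prop where
  cons : ¬ Der T Δ .falsum
  total : ∀ φ, φ ∈ Δ ∨ φ.neg ∈ Δ
  wit : ∀ x φ, ∃ y, N ≤ y ∧ wit x φ y ∈ Δ

namespace Hk

variable {N : ℕ} {Δ : Set Formula}

theorem closed (H : Hk T N Δ) {φ : Formula} (d : Der T Δ φ) : φ ∈ Δ := by
  rcases H.total φ with h | h
  · exact h
  · exact (H.cons (Der.neg_elim (.hyp h) d)).elim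

theorem mp (H : Hk T N Δ) {φ ψ : Formula} (h1 : φ.imp ψ ∈ Δ) (h2 : φ ∈ Δ) : ψ ∈ Δ :=
  H.closed (.mp (.hyp h1) (.hyp h2))

theorem lg (H : Hk T N Δ) {φ : Formula} (h : LogicalAxiom φ) : φ ∈ Δ := H.closed (.lg h)

theorem falsum (H : Hk T N Δ) : Formula.falsum ∉ Δ := fun h => H.cons (.hyp h)

theorem neg (H : Hk T N Δ) {φ : Formula} : φ.neg ∈ Δ ↔ φ ∉ Δ := by
  constructor
  · intro h1 h2; exact H.cons (Der.neg_elim (.hyp h1) (.hyp h2))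
  · intro h; exact (H.total φ).resolve_left h

theorem and (H : Hk T N Δ) {φ ψ : Formula} : φ.and ψ ∈ Δ ↔ φ ∈ Δ ∧ ψ ∈ Δ := by
  constructor
  · intro h; exact ⟨H.mp (H.lg (.andE1 _ _)) h, H.mp (H.lg (.andE2 _ _)) h⟩
  · intro h; exact H.mp (H.mp (H.lg (.andI _ _)) h.1) h.2

theorem imp (H : Hk T N Δ) {φ ψ : Formula} : φ.imp ψ ∈ Δ ↔ (φ ∈ Δ → ψ ∈ Δ) := by
  constructor
  · intro h h2; exact H.mp h h2
  · intro h
    by_cases h1 : φ ∈ Δ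
    · exact H.mp (H.lg (.imp1 _ _)) (h h1)
    · exact H.mp (H.lg (.negE _ _)) (H.neg.2 h1)

theorem or (H : Hk T N Δ) {φ ψ : Formula} : φ.or ψ ∈ Δ ↔ φ ∈ Δ ∨ ψ ∈ Δ := by
  constructor
  · intro h
    by_contra! hc
    exact H.falsum (H.mp (H.mp (H.mp (H.lg (.orE φ ψ .falsum)) (H.imp.2 fun h' => (hc.1 h').elim))
      (H.imp.2 fun h' => (hc.2 h').elim)) h)
  · rintro (h | h)
    · exact H.mp (H.lg (.orI1 _ _)) h
    · exact H.mp (H.lg (.orI2 _ _)) h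

theorem all (H : Hk T N Δ) {x : ℕ} {φ : Formula}
    (hf : ∀ t : Term, (∀ y ∈ t.fv, N ≤ y) → φ.freeFor t x) :
    Formula.all x φ ∈ Δ ↔ ∀ t : Term, (∀ y ∈ t.fv, N ≤ y) → φ.subst x t ∈ Δ := by
  constructor
  · intro h t ht; exact H.mp (H.lg (.allE x t φ (hf t ht))) h
  · intro h
    obtain ⟨y, hy, hw⟩ := H.wit x φ
    exact H.mp hw (h (Term.var y) (by simpa [Term.fv] using hy))

theorem ex (H : Hk T N Δ) {x : ℕ} {φ : Formula}
    (hf : ∀ t : Term, (∀ y ∈ t.fv, N ≤ y) → φ.freeFor t x) :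
    Formula.ex x φ ∈ Δ ↔ ∃ t : Term, (∀ y ∈ t.fv, N ≤ y) ∧ φ.subst x t ∈ Δ := by
  constructor
  · intro h
    by_contra! hc
    have h1 : Formula.all x φ.neg ∈ Δ := by
      rw [H.all (φ := φ.neg) hf]
      intro t ht
      exact H.neg.2 (hc t ht)
    have h2 : Formula.all x (φ.imp .falsum) ∈ Δ := by
      refine H.mp (H.mp (H.closed (.thm (prov_all_dist x φ.neg (φ.imp .falsum)))) ?_) h1
      exact H.closed (.thm (.gen x (.logic (.negE _ _))))
    exact H.falsum (H.mp (H.mp (H.lg (.exE x φ .falsum (by simp [Formula.fv]))) h2) h)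
  · rintro ⟨t, ht, h⟩; exact H.mp (H.lg (.exI x t φ (hf t ht))) h

end Hk

/-- Terms built from Henkin variables. -/
def HT (N : ℕ) : Type := {t : Term // ∀ y ∈ t.fv, N ≤ y}

def hset {N : ℕ} {Δ : Set Formula} (H : Hk T N Δ) : Setoid (HT N) where
  r t u := Formula.eq t.1 u.1 ∈ Δ
  iseqv := ⟨fun t => H.lg (.eqRefl _), fun {t u} h => H.mp (H.lg (.eqSymm _ _)) h,
    fun {t u w} h h' => H.mp (H.mp (H.lg (.eqTrans _ _ _)) h) h'⟩

def HM {N : ℕ} {Δ : Set Formula} (H : Hk T N Δ) : Type := Quotient (hset H)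

def HM.mk {N : ℕ} {Δ : Set Formula} (H : Hk T N Δ) (t : HT N) : HM H := Quotient.mk (hset H) t

def HT.zero {N : ℕ} : HT N := ⟨.zero, by simp [Term.fv]⟩
def HT.succ {N : ℕ} (t : HT N) : HT N := ⟨.succ t.1, by simpa [Term.fv] using t.2⟩
def HT.add {N : ℕ} (t u : HT N) : HT N := ⟨.add t.1 u.1, by
  have := t.2; have := u.2; simp [Term.fv]; grind⟩
def HT.mul {N : ℕ} (t u : HT N) : HT N := ⟨.mul t.1 u.1, by
  have := t.2; have := u.2; simp [Term.fv]; grind⟩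

instance hmAr {N : ℕ} {Δ : Set Formula} (H : Hk T N Δ) : Ar (HM H) where
  zero := HM.mk H HT.zero
  succ := Quotient.map (sa := hset H) (sb := hset H) HT.succ
    (fun t u h => H.mp (H.lg (.eqSucc _ _)) h)
  add := Quotient.map₂ (sa := hset H) (sb := hset H) (sc := hset H) HT.add
    (fun t u h t' u' h' => H.mp (H.mp (H.lg (.eqAdd _ _ _ _)) h) h')
  mul := Quotient.map₂ (sa := hset H) (sb := hset H) (sc := hset H) HT.mul
    (fun t u h t' u' h' => H.mp (H.mp (H.lg (.eqMul _ _ _ _)) h) h')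
  le := Quotient.lift₂ (s₁ := hset H) (s₂ := hset H) (fun t u => Formula.le t.1 u.1 ∈ Δ)
    (fun t u t' u' h h' => propext
      ⟨fun k => H.mp (H.mp (H.mp (H.lg (.eqLe _ _ _ _)) h) h') k,
       fun k => H.mp (H.mp (H.mp (H.lg (.eqLe _ _ _ _)) (H.mp (H.lg (.eqSymm _ _)) h))
        (H.mp (H.lg (.eqSymm _ _)) h')) k⟩)

theorem ht_substAll {N : ℕ} (t : Term) (s : ℕ → HT N) :
    ∀ y ∈ (t.substAll (fun i => (s i).1)).fv, N ≤ y := by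
  intro y hy
  obtain ⟨x, _, h⟩ := t.fv_substAll _ y hy
  exact (s x).2 y h

theorem term_truth {N : ℕ} {Δ : Set Formula} (H : Hk T N Δ) (t : Term) (s : ℕ → HT N) :
    t.mval (fun i => HM.mk H (s i)) =
      HM.mk H ⟨t.substAll (fun i => (s i).1), ht_substAll t s⟩ := by
  induction t with
  | var x => rfl
  | zero => rfl
  | succ t ih => simp only [Term.mval, ih]; rfl
  | add t u ih1 ih2 => simp only [Term.mval, ih1, ih2]; rfl
  | mul t u ih1 ih2 => simp only [Term.mval, ih1, ih2]; rfl

theorem upd_mk {N : ℕ} {Δ : Set Formula} (H : Hk T N Δ) (s : ℕ → HT N) (x : ℕ) (t : HT N) :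
    update (fun i => HM.mk H (s i)) x (HM.mk H t) = fun i => HM.mk H (update s x t i) := by
  funext i
  by_cases hi : i = x
  · subst hi; simp
  · simp [hi]

theorem subst_upd {N : ℕ} (φ : Formula) (x : ℕ) (hb : φ.bnd ≤ N) (hx : x < N) (s : ℕ → HT N)
    (t : HT N) :
    (φ.substAll (update (fun i => (s i).1) x (Term.var x))).subst x t.1 =
      φ.substAll (fun i => (update s x t i).1) := by
  rw [Formula.subst, Formula.substAll_comp N φ hb]
  · congr 1
    funext i
    by_cases hi : i = x
    · subst hi; simp [Term.substAll]
    · simp only [ne_eq, hi, not_false_eq_true, update_of_ne]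
      conv_rhs => rw [← Term.substAll_var (s i).1]
      apply Term.substAll_congr
      intro y hy
      have := (s i).2 y hy
      simp [show y ≠ x by omega]
  · intro y hy i hi hm
    by_cases hix : i = x
    · subst hix; simp [Term.fv] at hm; exact absurd hm.symm hi
    · simp only [ne_eq, hix, not_false_eq_true, update_of_ne] at hm
      have := (s i).2 y hm
      omega

theorem truth {N : ℕ} {Δ : Set Formula} (H : Hk T N Δ) (φ : Formula) (hn : φ.noBox)
    (hb : φ.bnd ≤ N) (s : ℕ → HT N) :
    φ.mval (fun i => HM.mk H (s i)) ↔ φ.substAll (fun i => (s i).1) ∈ Δ := by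
  induction φ generalizing s with
  | falsum => simp [Formula.mval, Formula.substAll, H.falsum]
  | box => exact hn.elim
  | eq t u =>
    simp only [Formula.mval, term_truth, Formula.substAll]
    exact Quotient.eq (r := hset H)
  | le t u =>
    simp only [Formula.mval, term_truth, Formula.substAll]
    rfl
  | neg φ ih => simp only [Formula.mval, Formula.substAll]; rw [H.neg, ih hn hb]
  | and φ ψ ih1 ih2 =>
    simp only [Formula.bnd, sup_le_iff] at hb
    simp only [Formula.mval, Formula.substAll]; rw [H.and, ih1 hn.1 hb.1, ih2 hn.2 hb.2]
  | or φ ψ ih1 ih2 =>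
    simp only [Formula.bnd, sup_le_iff] at hb
    simp only [Formula.mval, Formula.substAll]; rw [H.or, ih1 hn.1 hb.1, ih2 hn.2 hb.2]
  | imp φ ψ ih1 ih2 =>
    simp only [Formula.bnd, sup_le_iff] at hb
    simp only [Formula.mval, Formula.substAll]; rw [H.imp, ih1 hn.1 hb.1, ih2 hn.2 hb.2]
  | all x φ ih =>
    simp only [Formula.bnd, sup_le_iff] at hb
    simp only [Formula.mval, Formula.substAll]
    rw [H.all (fun t ht => Formula.freeFor_high N φ hb.2 t ht x _)]
    constructor
    · intro h t ht
      obtain ⟨τ, hτ⟩ : ∃ τ : HT N, τ.1 = t := ⟨⟨t, ht⟩, rfl⟩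
      subst hτ
      have := h (HM.mk H τ)
      rw [upd_mk, ih hn hb.2] at this
      rw [subst_upd φ x hb.2 (by omega) s τ]
      exact this
    · intro h m
      obtain ⟨t, rfl⟩ := Quotient.exists_rep m
      have := h t.1 t.2
      rw [subst_upd φ x hb.2 (by omega) s t] at this
      have h2 := upd_mk H s x t
      rw [HM.mk] at h2
      rw [h2, ih hn hb.2]
      exact this
  | ex x φ ih =>
    simp only [Formula.bnd, sup_le_iff] at hb
    simp only [Formula.mval, Formula.substAll]
    rw [H.ex (fun t ht => Formula.freeFor_high N φ hb.2 t ht x _)]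
    constructor
    · rintro ⟨m, h⟩
      obtain ⟨t, rfl⟩ := Quotient.exists_rep m
      have h2 := upd_mk H s x t
      rw [HM.mk] at h2
      rw [h2, ih hn hb.2] at h
      refine ⟨t.1, t.2, ?_⟩
      rw [subst_upd φ x hb.2 (by omega) s t]
      exact h
    · rintro ⟨t, ht, h⟩
      obtain ⟨τ, hτ⟩ : ∃ τ : HT N, τ.1 = t := ⟨⟨t, ht⟩, rfl⟩
      subst hτ
      refine ⟨HM.mk H τ, ?_⟩
      rw [upd_mk, ih hn hb.2]
      rw [subst_upd φ x hb.2 (by omega) s τ] at h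
      exact h

/-! Universal closures -/

def cl : ℕ → Formula → Formula
  | 0, φ => φ
  | n + 1, φ => .all n (cl n φ)

theorem cl_noBox (n : ℕ) (φ : Formula) (h : φ.noBox) : (cl n φ).noBox := by
  induction n with
  | zero => exact h
  | succ n ih => exact ih

theorem cl_bnd (n : ℕ) (φ : Formula) : (cl n φ).bnd ≤ max n φ.bnd := by
  induction n with
  | zero => simp [cl]
  | succ n ih => simp only [cl, Formula.bnd]; omega

theorem cl_fv (n : ℕ) (φ : Formula) : ∀ x ∈ (cl n φ).fv, x ∈ φ.fv ∧ n ≤ x := by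
  induction n with
  | zero => simp [cl]
  | succ n ih =>
    intro x hx
    simp only [cl, Formula.fv, Finset.mem_erase] at hx
    have := ih x hx.2
    exact ⟨this.1, by omega⟩

theorem cl_prov (n : ℕ) (φ : Formula) (h : Provable T φ) : Provable T (cl n φ) := by
  induction n with
  | zero => exact h
  | succ n ih => exact .gen n ih

theorem cl_mval {M : Type} [Ar M] (n : ℕ) (φ : Formula) (v w : ℕ → M) (h : (cl n φ).mval v)
    (hw : ∀ i, n ≤ i → w i = v i) : φ.mval w := by
  induction n generalizing v with
  | zero =>
    have : w = v := funext fun i => hw i (Nat.zero_le i)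
    rw [this]; exact h
  | succ n ih =>
    apply ih (update v n (w n)) (h (w n))
    intro i hi
    by_cases hin : i = n
    · subst hin; simp
    · simp [hin, hw i (by omega)]

theorem thm_true {N : ℕ} {Δ : Set Formula} (H : Hk T N Δ) (φ : Formula) (hn : φ.noBox)
    (hb : φ.bnd ≤ N) (hp : Provable T φ) (w : ℕ → HM H) : φ.mval w := by
  have hs : (cl N φ).fv = ∅ := by
    apply Finset.eq_empty_of_forall_notMem
    intro x hx
    have := cl_fv N φ x hx
    have := φ.fv_lt x this.1
    omega
  have h1 := truth H (cl N φ) (cl_noBox N φ hn) (by have := cl_bnd N φ; omega) (fun _ => HT.zero)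
  rw [Formula.substAll_sentence _ hs] at h1
  have h2 := h1.2 (H.closed (.thm (cl_prov N φ hp)))
  rw [Formula.mval_congr _ _ w (by simp [hs])] at h2
  exact cl_mval N φ w w h2 (fun _ _ => rfl)

theorem Term.bnd_substAll_le (t : Term) (N : ℕ) (s : ℕ → Term) (hs : ∀ i, i < N → (s i).bnd ≤ N)
    (ht : t.bnd ≤ N) : (t.substAll s).bnd ≤ N := by
  induction t with
  | var x => exact hs x ht
  | _ => simp_all [Term.bnd, Term.substAll]

theorem Formula.bnd_substAll_le (φ : Formula) (N : ℕ) (s : ℕ → Term)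
    (hs : ∀ i, i < N → (s i).bnd ≤ N) (h : φ.bnd ≤ N) : (φ.substAll s).bnd ≤ N := by
  have key : ∀ (x : ℕ) (s : ℕ → Term), (∀ i, i < N → (s i).bnd ≤ N) →
      (∀ i, i < N → (update s x (Term.var x) i).bnd ≤ N) := by
    intro x s hs i hi
    by_cases hix : i = x
    · subst hix; simp [Term.bnd]; omega
    · simpa [hix] using hs i hi
  induction φ generalizing s with
  | falsum => simp [Formula.substAll, Formula.bnd]
  | eq t u =>
    simp only [Formula.bnd, sup_le_iff] at h
    simp [Formula.substAll, Formula.bnd, Term.bnd_substAll_le t N s hs h.1,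
      Term.bnd_substAll_le u N s hs h.2]
  | le t u =>
    simp only [Formula.bnd, sup_le_iff] at h
    simp [Formula.substAll, Formula.bnd, Term.bnd_substAll_le t N s hs h.1,
      Term.bnd_substAll_le u N s hs h.2]
  | all x φ ih =>
    simp only [Formula.bnd, sup_le_iff] at h
    simp only [Formula.substAll, Formula.bnd, sup_le_iff]
    exact ⟨h.1, ih _ (key x s hs) h.2⟩
  | ex x φ ih =>
    simp only [Formula.bnd, sup_le_iff] at h
    simp only [Formula.substAll, Formula.bnd, sup_le_iff]
    exact ⟨h.1, ih _ (key x s hs) h.2⟩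
  | neg φ ih => exact ih s hs h
  | box φ ih => exact ih s hs h
  | and φ ψ ih1 ih2 =>
    simp only [Formula.bnd, sup_le_iff] at h
    simp only [Formula.substAll, Formula.bnd, sup_le_iff]
    exact ⟨ih1 s hs h.1, ih2 s hs h.2⟩
  | or φ ψ ih1 ih2 =>
    simp only [Formula.bnd, sup_le_iff] at h
    simp only [Formula.substAll, Formula.bnd, sup_le_iff]
    exact ⟨ih1 s hs h.1, ih2 s hs h.2⟩
  | imp φ ψ ih1 ih2 =>
    simp only [Formula.bnd, sup_le_iff] at h
    simp only [Formula.substAll, Formula.bnd, sup_le_iff]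
    exact ⟨ih1 s hs h.1, ih2 s hs h.2⟩

theorem Formula.noBox_substAll (φ : Formula) (s : ℕ → Term) (h : φ.noBox) :
    (φ.substAll s).noBox := by
  induction φ generalizing s <;> simp_all [Formula.noBox, Formula.substAll]

theorem upd_bnd (N x : ℕ) (t : Term) (ht : t.bnd ≤ N) :
    ∀ i, i < N → (update Term.var x t i).bnd ≤ N := by
  intro i hi
  by_cases hix : i = x
  · subst hix; simpa using ht
  · simp [hix, Term.bnd]; omega

theorem hm_isMdl {N : ℕ} {Δ : Set Formula} (H : Hk T N Δ) (hN : 3 ≤ N) (hT : Extends T PAK) :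
    IsMdl N (HM H) := by
  have base : ∀ φ ∈ baseAxioms, Provable T φ := fun φ h => hT φ (Or.inl (Or.inl h))
  have hb : ∀ φ ∈ baseAxioms, φ.noBox → φ.bnd ≤ 3 → ∀ w : ℕ → HM H, φ.mval w :=
    fun φ h h1 h2 w => thm_true H φ h1 (by omega) (base φ h) w
  constructor
  · intro a
    have := hb succNeZero (by simp [baseAxioms]) (by simp [succNeZero, Formula.noBox])
      (by simp [succNeZero, Formula.bnd, Term.bnd]) (fun _ => a)
    simpa [succNeZero, Formula.mval, Term.mval] using this
  · intro a b
    have := hb succInj (by simp [baseAxioms]) (by simp [succInj, Formula.noBox])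
      (by simp [succInj, Formula.bnd, Term.bnd]) (fun i => if i = 0 then a else b)
    simpa [succInj, Formula.mval, Term.mval] using this
  · intro a
    have := hb addZero (by simp [baseAxioms]) (by simp [addZero, Formula.noBox])
      (by simp [addZero, Formula.bnd, Term.bnd]) (fun _ => a)
    simpa [addZero, Formula.mval, Term.mval] using this
  · intro a b
    have := hb addSucc (by simp [baseAxioms]) (by simp [addSucc, Formula.noBox])
      (by simp [addSucc, Formula.bnd, Term.bnd]) (fun i => if i = 0 then a else b)
    simpa [addSucc, Formula.mval, Term.mval] using this
  · intro a
    have := hb mulZero (by simp [baseAxioms]) (by simp [mulZero, Formula.noBox])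
      (by simp [mulZero, Formula.bnd, Term.bnd]) (fun _ => a)
    simpa [mulZero, Formula.mval, Term.mval] using this
  · intro a b
    have := hb mulSucc (by simp [baseAxioms]) (by simp [mulSucc, Formula.noBox])
      (by simp [mulSucc, Formula.bnd, Term.bnd]) (fun i => if i = 0 then a else b)
    simpa [mulSucc, Formula.mval, Term.mval] using this
  · intro a b
    have := hb leDef (by simp [baseAxioms]) (by simp [leDef, Formula.noBox, Formula.iff])
      (by simp [leDef, Formula.bnd, Term.bnd, Formula.iff]) (fun i => if i = 0 then a else b)
    simp [leDef, Formula.mval, Term.mval, Formula.iff] at this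
    exact ⟨this.1, fun ⟨c, hc⟩ => this.2 c hc⟩
  · intro φ hn hbd x hx v h0 hs
    have hp : Provable T (inductionAx x φ) := hT _ (Or.inl (Or.inr ⟨x, φ, rfl⟩))
    have := thm_true H (inductionAx x φ)
      (by
        simp only [inductionAx, Formula.noBox]
        exact ⟨⟨φ.noBox_substAll _ hn, hn, φ.noBox_substAll _ hn⟩, hn⟩)
      (by
        simp only [inductionAx, Formula.bnd, sup_le_iff]
        have h1 := φ.bnd_substAll_le N _ (upd_bnd N x .zero (by simp [Term.bnd])) hbd
        have h2 := φ.bnd_substAll_le N _ (upd_bnd N x (.succ (.var x)) (by simpa [Term.bnd])) hbd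
        exact ⟨⟨h1, hx, hbd, h2⟩, hx, hbd⟩) hp v
    simp only [inductionAx, Formula.mval] at this
    rw [Formula.mval_subst x _ φ v (φ.freeFor_closed x _ rfl)] at this
    apply this
    refine ⟨h0, fun a ha => ?_⟩
    rw [Formula.mval_subst x _ φ _ (φ.freeFor_succ_self x)]
    simpa [Term.mval] using hs a ha

/-- Completeness, in the form used below. -/
theorem complete (hT : Extends T PAK) (χ : Formula) (hn : χ.noBox) (hs : χ.fv = ∅)
    (h : ∀ᶠ N in Filter.atTop, ∀ (M : Type) [Ar M], IsMdl N M → ∀ v : ℕ → M, χ.mval v) :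
    Provable T χ := by
  obtain ⟨N, hN, h⟩ := ((Filter.eventually_ge_atTop (max 3 χ.bnd)).and h).exists
  by_contra hc
  obtain ⟨Δ, h1, h2, h3, h4⟩ := exists_henkin N χ hc
  have H : Hk T N Δ := ⟨h2, h3, h4⟩
  have h5 := h (HM H) (hm_isMdl H (by omega) hT) (fun _ => HM.mk H HT.zero)
  rw [truth H χ hn (by omega), Formula.substAll_sentence _ hs] at h5
  exact H.neg.1 h1 h5

end ModalArith


namespace ModalArith

open Function

variable {T : Set Formula}

/-! Elementary arithmetic in models -/

namespace IsMdl

variable {N : ℕ} {M : Type} [Ar M]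

theorem zero_add (h : IsMdl N M) (hN : 5 ≤ N) (a : M) : Ar.add Ar.zero a = a := by
  have := h.ind (.eq (.add .zero (.var 0)) (.var 0)) (by simp [Formula.noBox])
    (by simp [Formula.bnd, Term.bnd]; omega) 0 (by omega) (fun _ => a)
  simp only [Formula.mval, Term.mval, update_self] at this
  exact this (h.add_zero _) (fun b hb => by rw [h.add_succ, hb]) a

theorem succ_add (h : IsMdl N M) (hN : 5 ≤ N) (a b : M) :
    Ar.add (Ar.succ a) b = Ar.succ (Ar.add a b) := by
  have := h.ind (.eq (.add (.succ (.var 1)) (.var 0)) (.succ (.add (.var 1) (.var 0))))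
    (by simp [Formula.noBox])
    (by simp [Formula.bnd, Term.bnd]; omega) 0 (by omega) (fun _ => a)
  simp only [Formula.mval, Term.mval, update_self, ne_eq, one_ne_zero, not_false_eq_true,
    update_of_ne] at this
  exact this (by rw [h.add_zero, h.add_zero]) (fun b hb => by rw [h.add_succ, hb, h.add_succ]) b

theorem add_comm (h : IsMdl N M) (hN : 5 ≤ N) (a b : M) : Ar.add a b = Ar.add b a := by
  have := h.ind (.eq (.add (.var 1) (.var 0)) (.add (.var 0) (.var 1)))
    (by simp [Formula.noBox])
    (by simp [Formula.bnd, Term.bnd]; omega) 0 (by omega) (fun _ => a)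
  simp only [Formula.mval, Term.mval, update_self, ne_eq, one_ne_zero, not_false_eq_true,
    update_of_ne] at this
  exact this (by rw [h.add_zero, h.zero_add hN])
    (fun b hb => by rw [h.add_succ, hb, h.succ_add hN]) b

theorem add_assoc (h : IsMdl N M) (hN : 5 ≤ N) (a b c : M) :
    Ar.add (Ar.add a b) c = Ar.add a (Ar.add b c) := by
  have := h.ind (.eq (.add (.add (.var 1) (.var 2)) (.var 0)) (.add (.var 1) (.add (.var 2) (.var 0))))
    (by simp [Formula.noBox])
    (by simp [Formula.bnd, Term.bnd]; omega) 0 (by omega) (fun i => if i = 1 then a else b)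
  simp [Formula.mval, Term.mval] at this
  exact this (by rw [h.add_zero, h.add_zero])
    (fun b hb => by rw [h.add_succ, hb, h.add_succ, h.add_succ]) c

theorem cancel (h : IsMdl N M) (hN : 5 ≤ N) (a b c : M) :
    Ar.add a c = Ar.add b c → a = b := by
  have := h.ind (.imp (.eq (.add (.var 1) (.var 0)) (.add (.var 2) (.var 0))) (.eq (.var 1) (.var 2)))
    (by simp [Formula.noBox])
    (by simp [Formula.bnd, Term.bnd]; omega) 0 (by omega) (fun i => if i = 1 then a else b)
  simp [Formula.mval, Term.mval] at this
  exact this (by rw [h.add_zero, h.add_zero]; exact id)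
    (fun c hc hb => by rw [h.add_succ, h.add_succ] at hb; exact hc (h.succ_inj _ _ hb)) c

theorem zero_or_succ (h : IsMdl N M) (hN : 5 ≤ N) (a : M) :
    a = Ar.zero ∨ ∃ b, a = Ar.succ b := by
  have := h.ind (.or (.eq (.var 0) .zero) (.ex 1 (.eq (.var 0) (.succ (.var 1)))))
    (by simp [Formula.noBox])
    (by simp [Formula.bnd, Term.bnd]; omega) 0 (by omega) (fun i => a)
  simp [Formula.mval, Term.mval] at this
  exact this a

theorem le_refl (h : IsMdl N M) (a : M) : Ar.le a a :=
  (h.le_def _ _).2 ⟨_, h.add_zero a⟩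

theorem zero_le (h : IsMdl N M) (hN : 5 ≤ N) (a : M) : Ar.le Ar.zero a :=
  (h.le_def _ _).2 ⟨_, h.zero_add hN a⟩

theorem le_trans (h : IsMdl N M) (hN : 5 ≤ N) {a b c : M} (h1 : Ar.le a b) (h2 : Ar.le b c) :
    Ar.le a c := by
  obtain ⟨d, rfl⟩ := (h.le_def _ _).1 h1
  obtain ⟨e, rfl⟩ := (h.le_def _ _).1 h2
  exact (h.le_def _ _).2 ⟨_, (h.add_assoc hN _ _ _).symm⟩

theorem le_succ (h : IsMdl N M) (a : M) : Ar.le a (Ar.succ a) :=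
  (h.le_def _ _).2 ⟨Ar.succ Ar.zero, by rw [h.add_succ, h.add_zero]⟩

theorem lt_or_le (h : IsMdl N M) (hN : 5 ≤ N) (a b : M) : Ar.le (Ar.succ a) b ∨ Ar.le b a := by
  have := h.ind (.or (.le (.succ (.var 0)) (.var 1)) (.le (.var 1) (.var 0)))
    (by simp [Formula.noBox])
    (by simp [Formula.bnd, Term.bnd]; omega) 0 (by omega) (fun i => b)
  simp [Formula.mval, Term.mval] at this
  refine this ?_ ?_ a
  · obtain rfl | ⟨c, rfl⟩ := h.zero_or_succ hN b
    · exact Or.inr (h.le_refl _)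
    · exact Or.inl ((h.le_def _ _).2 ⟨c, by rw [h.succ_add hN, h.zero_add hN]⟩)
  · rintro a (h1 | h1)
    · obtain ⟨c, rfl⟩ := (h.le_def _ _).1 h1
      obtain rfl | ⟨d, rfl⟩ := h.zero_or_succ hN c
      · rw [h.add_zero]; exact Or.inr (h.le_refl _)
      · exact Or.inl ((h.le_def _ _).2 ⟨d, by rw [h.succ_add hN, h.add_succ]⟩)
    · exact Or.inr (h.le_trans hN h1 (h.le_succ _))

theorem lt_le_false (h : IsMdl N M) (hN : 5 ≤ N) {a b : M} (h1 : Ar.le (Ar.succ a) b)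
    (h2 : Ar.le b a) : False := by
  obtain ⟨c, rfl⟩ := (h.le_def _ _).1 h1
  obtain ⟨d, h2⟩ := (h.le_def _ _).1 h2
  rw [h.succ_add hN, h.succ_add hN, h.add_assoc hN, h.add_comm hN, ← h.add_succ] at h2
  have h3 : Ar.add (Ar.succ (Ar.add c d)) a = Ar.add Ar.zero a := by
    rw [h.zero_add hN, h.succ_add hN, ← h.add_succ]; exact h2
  exact h.succ_ne _ (h.cancel hN _ _ _ h3)

theorem lt_succ (h : IsMdl N M) (hN : 5 ≤ N) {a b : M} : Ar.le (Ar.succ a) (Ar.succ b) ↔ Ar.le a b := by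
  rw [h.le_def, h.le_def]
  refine exists_congr fun c => ?_
  rw [h.succ_add hN]
  exact ⟨h.succ_inj _ _, fun h => by rw [h]⟩

theorem le_iff (h : IsMdl N M) (hN : 5 ≤ N) {a b : M} :
    Ar.le a b ↔ Ar.le (Ar.succ a) b ∨ a = b := by
  constructor
  · intro h1
    obtain ⟨c, rfl⟩ := (h.le_def _ _).1 h1
    obtain rfl | ⟨d, rfl⟩ := h.zero_or_succ hN c
    · rw [h.add_zero]; exact Or.inr rfl
    · rw [h.add_succ, h.lt_succ hN]; exact Or.inl ((h.le_def _ _).2 ⟨d, rfl⟩)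
  · rintro (h1 | rfl)
    · exact h.le_trans hN (h.le_succ _) h1
    · exact h.le_refl _

theorem le_add_left (h : IsMdl N M) (a b : M) : Ar.le a (Ar.add a b) :=
  (h.le_def _ _).2 ⟨b, rfl⟩

theorem le_add_right (h : IsMdl N M) (hN : 5 ≤ N) (a b : M) : Ar.le b (Ar.add a b) :=
  (h.le_def _ _).2 ⟨a, h.add_comm hN _ _⟩

end IsMdl

/-- Standard numbers in a model. -/
def num (M : Type) [Ar M] : ℕ → M
  | 0 => Ar.zero
  | n + 1 => Ar.succ (num M n)

theorem Term.mval_numeral {M : Type} [Ar M] (n : ℕ) (v : ℕ → M) :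
    (Term.numeral n).mval v = num M n := by
  induction n with
  | zero => rfl
  | succ n ih => simp [Term.numeral, Term.mval, num, ih]

namespace IsMdl

variable {N : ℕ} {M : Type} [Ar M]

theorem num_add (h : IsMdl N M) (m n : ℕ) : num M (m + n) = Ar.add (num M m) (num M n) := by
  induction n with
  | zero => exact (h.add_zero _).symm
  | succ n ih => rw [num, h.add_succ, ← ih]; rfl

theorem num_mul (h : IsMdl N M) (m n : ℕ) : num M (m * n) = Ar.mul (num M m) (num M n) := by
  induction n with
  | zero => exact (h.mul_zero _).symm
  | succ n ih => rw [num, h.mul_succ, ← ih, ← h.num_add]; rfl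

theorem num_le (h : IsMdl N M) (hN : 5 ≤ N) (m n : ℕ) : Ar.le (num M m) (num M n) ↔ m ≤ n := by
  have key : ∀ m n : ℕ, m ≤ n → Ar.le (num M m) (num M n) := by
    intro m n hmn
    obtain ⟨c, rfl⟩ := Nat.exists_eq_add_of_le hmn
    rw [h.num_add]; exact h.le_add_left _ _
  refine ⟨fun h1 => ?_, key m n⟩
  by_contra hc
  exact h.lt_le_false hN (key (n + 1) m (by omega)) h1

theorem num_inj (h : IsMdl N M) (hN : 5 ≤ N) (m n : ℕ) : num M m = num M n ↔ m = n := by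
  refine ⟨fun h1 => ?_, fun h => by rw [h]⟩
  have h2 := (h.num_le hN m n).1 (h1 ▸ h.le_refl _)
  have h3 := (h.num_le hN n m).1 (h1 ▸ h.le_refl _)
  omega

theorem lt_num (h : IsMdl N M) (hN : 5 ≤ N) (n : ℕ) (a : M) (ha : Ar.le (Ar.succ a) (num M n)) :
    ∃ k < n, a = num M k := by
  induction n with
  | zero => exact (h.lt_le_false hN ha (h.zero_le hN _)).elim
  | succ n ih =>
    rw [num, h.lt_succ hN, h.le_iff hN] at ha
    obtain ha | rfl := ha
    · obtain ⟨k, hk, rfl⟩ := ih ha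
      exact ⟨k, by omega, rfl⟩
    · exact ⟨n, by omega, rfl⟩

theorem term_num (h : IsMdl N M) (t : Term) (v : ℕ → ℕ) :
    t.mval (fun i => num M (v i)) = num M (t.val v) := by
  induction t with
  | var x => rfl
  | zero => rfl
  | succ t ih => simp [Term.mval, Term.val, num, ih]
  | add t u ih1 ih2 => simp [Term.mval, Term.val, ih1, ih2, h.num_add]
  | mul t u ih1 ih2 => simp [Term.mval, Term.val, ih1, ih2, h.num_mul]

theorem upd_num (v : ℕ → ℕ) (x k : ℕ) :
    update (fun i => num M (v i)) x (num M k) = fun i => num M (update v x k i) := by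
  funext i
  by_cases hi : i = x
  · subst hi; simp
  · simp [hi]

end IsMdl

theorem Term.val_congr (t : Term) (v w : ℕ → ℕ) (h : ∀ x ∈ t.fv, v x = w x) :
    t.val v = t.val w := by
  induction t <;> simp_all [Term.fv, Term.val]

theorem Term.val_upd (t : Term) (x : ℕ) (hx : x ∉ t.fv) (v : ℕ → ℕ) (k : ℕ) :
    t.val (update v x k) = t.val v :=
  t.val_congr _ _ fun y hy => update_of_ne (by rintro rfl; exact hx hy) _ _

theorem Term.mval_upd {M : Type} [Ar M] (t : Term) (x : ℕ) (hx : x ∉ t.fv) (v : ℕ → M) (k : M) :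
    t.mval (update v x k) = t.mval v :=
  t.mval_congr _ _ fun y hy => update_of_ne (by rintro rfl; exact hx hy) _ _

theorem mval_ball {M : Type} [Ar M] {x : ℕ} {t : Term} (hx : x ∉ t.fv) (φ : Formula) (v : ℕ → M) :
    (Formula.ball x t φ).mval v ↔ ∀ a : M, Ar.le (Ar.succ a) (t.mval v) → φ.mval (update v x a) := by
  simp [Formula.ball, Formula.lt, Formula.mval, Term.mval, t.mval_upd x hx]

theorem mval_bex {M : Type} [Ar M] {x : ℕ} {t : Term} (hx : x ∉ t.fv) (φ : Formula) (v : ℕ → M) :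
    (Formula.bex x t φ).mval v ↔ ∃ a : M, Ar.le (Ar.succ a) (t.mval v) ∧ φ.mval (update v x a) := by
  simp [Formula.bex, Formula.lt, Formula.mval, Term.mval, t.mval_upd x hx]

theorem val_ball {x : ℕ} {t : Term} (hx : x ∉ t.fv) (φ : Formula) (v : ℕ → ℕ) :
    (Formula.ball x t φ).val v ↔ ∀ a : ℕ, a < t.val v → φ.val (update v x a) := by
  simp [Formula.ball, Formula.lt, Formula.val, Term.val, t.val_upd x hx]

theorem val_bex {x : ℕ} {t : Term} (hx : x ∉ t.fv) (φ : Formula) (v : ℕ → ℕ) :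
    (Formula.bex x t φ).val v ↔ ∃ a : ℕ, a < t.val v ∧ φ.val (update v x a) := by
  simp [Formula.bex, Formula.lt, Formula.val, Term.val, t.val_upd x hx]

/-- Absoluteness of bounded formulas. -/
theorem IsMdl.delta0 {N : ℕ} {M : Type} [Ar M] (h : IsMdl N M) (hN : 5 ≤ N) {φ : Formula}
    (hφ : IsDelta0 φ) (v : ℕ → ℕ) : φ.mval (fun i => num M (v i)) ↔ φ.val v := by
  induction hφ generalizing v with
  | falsum => rfl
  | eq t u => simp only [Formula.mval, Formula.val, h.term_num, h.num_inj hN]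
  | le t u => simp only [Formula.mval, Formula.val, h.term_num, h.num_le hN]
  | and _ _ ih1 ih2 => exact and_congr (ih1 v) (ih2 v)
  | or _ _ ih1 ih2 => exact or_congr (ih1 v) (ih2 v)
  | imp _ _ ih1 ih2 => exact imp_congr (ih1 v) (ih2 v)
  | neg _ ih => exact not_congr (ih v)
  | ball hx _ ih =>
    rw [mval_ball hx, val_ball hx, h.term_num]
    constructor
    · intro h1 a ha
      rw [← ih, ← IsMdl.upd_num]
      exact h1 _ ((h.num_le hN (a + 1) _).2 ha)
    · intro h1 a ha
      obtain ⟨k, hk, rfl⟩ := h.lt_num hN _ _ ha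
      rw [IsMdl.upd_num, ih]
      exact h1 k hk
  | bex hx _ ih =>
    rw [mval_bex hx, val_bex hx, h.term_num]
    constructor
    · rintro ⟨a, ha, h1⟩
      obtain ⟨k, hk, rfl⟩ := h.lt_num hN _ _ ha
      rw [IsMdl.upd_num, ih] at h1
      exact ⟨k, hk, h1⟩
    · rintro ⟨a, ha, h1⟩
      rw [← ih, ← IsMdl.upd_num] at h1
      exact ⟨_, (h.num_le hN (a + 1) _).2 ha, h1⟩

/-- Upward persistence of Σ₁ formulas. -/
theorem IsMdl.sigma1 {N : ℕ} {M : Type} [Ar M] (h : IsMdl N M) (hN : 5 ≤ N) {φ : Formula}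
    (hφ : IsSigma1 φ) (v : ℕ → ℕ) : φ.val v → φ.mval (fun i => num M (v i)) := by
  induction hφ generalizing v with
  | delta0 hd => exact (h.delta0 hN hd v).2
  | and _ _ ih1 ih2 => exact And.imp (ih1 v) (ih2 v)
  | or _ _ ih1 ih2 => exact Or.imp (ih1 v) (ih2 v)
  | ex _ ih =>
    rintro ⟨n, hn⟩
    refine ⟨num M n, ?_⟩
    rw [IsMdl.upd_num]; exact ih _ hn
  | ball hx _ ih =>
    rw [mval_ball hx, val_ball hx, h.term_num]
    intro h1 a ha
    obtain ⟨k, hk, rfl⟩ := h.lt_num hN _ _ ha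
    rw [IsMdl.upd_num]
    exact ih _ (h1 k hk)

theorem IsDelta0.noBox {φ : Formula} (h : IsDelta0 φ) : φ.noBox := by
  induction h <;> simp_all [Formula.noBox, Formula.ball, Formula.bex, Formula.lt]

theorem IsSigma1.noBox {φ : Formula} (h : IsSigma1 φ) : φ.noBox := by
  induction h <;> simp_all [Formula.noBox, Formula.ball, Formula.lt, IsDelta0.noBox]

/-- Σ₁-completeness. -/
theorem sigma1_complete (hT : Extends T PAK) {φ : Formula} (hφ : IsSigma1 φ) (hs : φ.fv = ∅)
    (w : ℕ → ℕ) (h : φ.val w) : Provable T φ := by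
  apply complete hT φ hφ.noBox hs
  filter_upwards [Filter.eventually_ge_atTop 5] with N hN M _ hM v
  rw [φ.mval_congr v (fun i => num M (w i)) (by simp [hs])]
  exact hM.sigma1 hN hφ w h

/-! The standard model -/

instance : Ar ℕ := ⟨0, Nat.succ, (· + ·), (· * ·), (· ≤ ·)⟩

theorem Term.mval_nat (t : Term) (v : ℕ → ℕ) : t.mval v = t.val v := by
  induction t with
  | var x => rfl
  | zero => rfl
  | succ t ih => simp only [Term.mval, Term.val, ih]; rfl
  | add t u ih1 ih2 => simp only [Term.mval, Term.val, ih1, ih2]; rfl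
  | mul t u ih1 ih2 => simp only [Term.mval, Term.val, ih1, ih2]; rfl

theorem Formula.mval_nat (φ : Formula) (v : ℕ → ℕ) : φ.mval v ↔ φ.val v := by
  induction φ generalizing v with
  | falsum => rfl
  | box => rfl
  | eq t u => simp only [Formula.mval, Formula.val, Term.mval_nat]
  | le t u => simp only [Formula.mval, Formula.val, Term.mval_nat]; rfl
  | neg φ ih => exact not_congr (ih v)
  | and φ ψ ih1 ih2 => exact and_congr (ih1 v) (ih2 v)
  | or φ ψ ih1 ih2 => exact or_congr (ih1 v) (ih2 v)
  | imp φ ψ ih1 ih2 => exact imp_congr (ih1 v) (ih2 v)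
  | all x φ ih => exact forall_congr' fun m => ih _
  | ex x φ ih => exact exists_congr fun m => ih _

theorem isMdl_nat (N : ℕ) : IsMdl N ℕ where
  succ_ne := Nat.succ_ne_zero
  succ_inj _ _ := Nat.succ.inj
  add_zero := Nat.add_zero
  add_succ := Nat.add_succ
  mul_zero := Nat.mul_zero
  mul_succ := Nat.mul_succ
  le_def a b := by
    show a ≤ b ↔ ∃ c, a + c = b
    exact ⟨fun h => ⟨b - a, by omega⟩, fun ⟨c, h⟩ => by omega⟩
  ind φ _ _ x _ v h0 hs a := by
    induction a with
    | zero => exact h0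
    | succ a ih => exact hs a ih

theorem num_nat (n : ℕ) : num ℕ n = n := by
  induction n with
  | zero => rfl
  | succ n ih => rw [num, ih]; rfl

theorem Formula.val_congr (φ : Formula) (v w : ℕ → ℕ)
    (h : ∀ x ∈ φ.fv, v x = w x) : φ.val v ↔ φ.val w := by
  rw [← Formula.mval_nat, ← Formula.mval_nat]; exact φ.mval_congr v w h

end ModalArith


namespace ModalArith

open Function

variable {T : Set Formula}

theorem Formula.mval_upd {M : Type} [Ar M] (φ : Formula) (x : ℕ) (hx : x ∉ φ.fv) (v : ℕ → M)
    (k : M) : φ.mval (update v x k) ↔ φ.mval v :=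
  φ.mval_congr _ _ fun y hy => update_of_ne (by rintro rfl; exact hx hy) _ _

/-- `φ'` is a bounded version of `φ`, with all existential witnesses bounded by variable `b`. -/
structure Bdd (φ φ' : Formula) (b : ℕ) : Prop where
  delta0 : IsDelta0 φ'
  fv : φ'.fv ⊆ insert b φ.fv
  sem : ∀ᶠ N in Filter.atTop, ∀ (M : Type) [Ar M], IsMdl N M → ∀ v : ℕ → M,
    (∀ m m', Ar.le m m' → φ'.mval (update v b m) → φ'.mval (update v b m')) ∧
    (φ.mval v ↔ ∃ m, φ'.mval (update v b m))

theorem IsMdl.bound2 {N : ℕ} {M : Type} [Ar M] (h : IsMdl N M) (hN : 5 ≤ N) (m m' : M) :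
    ∃ k, Ar.le m k ∧ Ar.le m' k :=
  ⟨Ar.add m m', h.le_add_left _ _, h.le_add_right hN _ _⟩

theorem exists_bdd {φ : Formula} (hφ : IsSigma1 φ) (b : ℕ) (hb : φ.bnd ≤ b) :
    ∃ φ', Bdd φ φ' b := by
  induction hφ with
  | @delta0 φ hd =>
    refine ⟨φ, hd, Finset.subset_insert _ _, ?_⟩
    have hbf := φ.fv_of_bnd b hb
    filter_upwards with N M _ hM v
    simp only [φ.mval_upd b hbf]
    exact ⟨fun _ _ _ h => h, fun h => ⟨v 0, h⟩, fun ⟨_, h⟩ => h⟩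
  | @and φ ψ h1 h2 ih1 ih2 =>
    simp only [Formula.bnd, sup_le_iff] at hb
    obtain ⟨φ', B1⟩ := ih1 hb.1
    obtain ⟨ψ', B2⟩ := ih2 hb.2
    refine ⟨φ'.and ψ', B1.delta0.and B2.delta0, ?_, ?_⟩
    · have := B1.fv; have := B2.fv
      simp only [Formula.fv]; grind
    · filter_upwards [B1.sem, B2.sem, Filter.eventually_ge_atTop 5] with N S1 S2 hN M _ hM v
      obtain ⟨m1, i1⟩ := S1 M hM v
      obtain ⟨m2, i2⟩ := S2 M hM v
      simp only [Formula.mval]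
      refine ⟨fun m m' hm h => ⟨m1 _ _ hm h.1, m2 _ _ hm h.2⟩, ?_⟩
      rw [i1, i2]
      constructor
      · rintro ⟨⟨m, hm⟩, ⟨m', hm'⟩⟩
        obtain ⟨k, hk1, hk2⟩ := hM.bound2 hN m m'
        exact ⟨k, m1 _ _ hk1 hm, m2 _ _ hk2 hm'⟩
      · rintro ⟨m, ha, hb⟩
        exact ⟨⟨m, ha⟩, ⟨m, hb⟩⟩
  | @or φ ψ h1 h2 ih1 ih2 =>
    simp only [Formula.bnd, sup_le_iff] at hb
    obtain ⟨φ', B1⟩ := ih1 hb.1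
    obtain ⟨ψ', B2⟩ := ih2 hb.2
    refine ⟨φ'.or ψ', B1.delta0.or B2.delta0, ?_, ?_⟩
    · have := B1.fv; have := B2.fv
      simp only [Formula.fv]; grind
    · filter_upwards [B1.sem, B2.sem, Filter.eventually_ge_atTop 5] with N S1 S2 hN M _ hM v
      obtain ⟨m1, i1⟩ := S1 M hM v
      obtain ⟨m2, i2⟩ := S2 M hM v
      simp only [Formula.mval]
      refine ⟨fun m m' hm h => h.imp (m1 _ _ hm) (m2 _ _ hm), ?_⟩
      rw [i1, i2, exists_or]
  | @ex x φ h1 ih =>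
    simp only [Formula.bnd, sup_le_iff] at hb
    obtain ⟨φ', B⟩ := ih hb.2
    have hxb : x ≠ b := by omega
    have hxt : x ∉ (Term.var b).fv := by simp [Term.fv, hxb]
    refine ⟨Formula.bex x (.var b) φ', .bex hxt B.delta0, ?_, ?_⟩
    · have := B.fv
      simp only [Formula.fv, Formula.bex, Formula.lt, Term.fv]; grind
    · filter_upwards [B.sem, Filter.eventually_ge_atTop 5] with N S hN M _ hM v
      simp only [mval_bex hxt, Term.mval, update_self, Formula.mval]
      constructor
      · rintro m m' hm ⟨a, ha, h⟩
        rw [update_comm hxb.symm] at h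
        refine ⟨a, hM.le_trans hN ha hm, ?_⟩
        rw [update_comm hxb.symm]
        exact (S M hM _).1 _ _ hm h
      · constructor
        · rintro ⟨a, ha⟩
          obtain ⟨m, hm⟩ := (S M hM _).2.1 ha
          obtain ⟨k, hk1, hk2⟩ := hM.bound2 hN m (Ar.succ a)
          refine ⟨k, a, hk2, ?_⟩
          rw [update_comm hxb.symm]
          exact (S M hM _).1 _ _ hk1 hm
        · rintro ⟨m, a, ha, h⟩
          rw [update_comm hxb.symm] at h
          exact ⟨a, (S M hM _).2.2 ⟨m, h⟩⟩
  | @ball x t φ hx h1 ih =>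
    simp only [Formula.ball, Formula.lt, Formula.bnd, Term.bnd, sup_le_iff] at hb
    obtain ⟨φ', B⟩ := ih hb.2.2
    have hxb : x ≠ b := by omega
    have hbt : b ∉ t.fv := fun h => by have := t.fv_lt b h; omega
    refine ⟨Formula.ball x t φ', .ball hx B.delta0, ?_, ?_⟩
    · have := B.fv
      simp only [Formula.fv, Formula.ball, Formula.lt, Term.fv]; grind
    · obtain ⟨z, hz⟩ : ∃ z, z = max (b + 1) φ'.bnd := ⟨_, rfl⟩
      have hzx : x ∉ (Term.var z).fv := by simp [Term.fv]; omega
      have hzt : z ∉ t.fv := fun h => by have := t.fv_lt z h; omega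
      have hzf : z ∉ φ'.fv := φ'.fv_of_bnd z (by omega)
      filter_upwards [B.sem, Filter.eventually_ge_atTop 5, Filter.eventually_gt_atTop z]
        with N S hN hNz M _ hM v
      simp only [mval_ball hx, t.mval_upd b hbt]
      constructor
      · intro m m' hm h a ha
        have := h a ha
        rw [update_comm hxb.symm] at this ⊢
        exact (S M hM _).1 _ _ hm this
      constructor
      · intro h
        have key := hM.ind (.ex b (.ball x (.var z) (.imp (.lt (.var x) t) φ')))
          (by simp [Formula.noBox, Formula.ball, Formula.lt, B.delta0.noBox])
          (by simp [Formula.ball, Formula.lt, Formula.bnd, Term.bnd]; omega) z hNz v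
        have e : ∀ c : M, (Formula.ex b (.ball x (.var z) (.imp (.lt (.var x) t) φ'))).mval
            (update v z c) ↔ ∃ m, ∀ a, Ar.le (Ar.succ a) c → Ar.le (Ar.succ a) (t.mval v) →
              φ'.mval (update (update v x a) b m) := by
          intro c
          simp only [Formula.mval, mval_ball hzx, Formula.lt, Term.mval]
          refine exists_congr fun m => forall_congr' fun a => ?_
          rw [t.mval_upd x hx, t.mval_upd b hbt, t.mval_upd z hzt,
            update_of_ne (by omega : z ≠ b), update_self, update_self,
            update_comm (by omega : z ≠ b), update_comm (by omega : z ≠ x),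
            φ'.mval_upd z hzf, update_comm hxb.symm]
        simp only [e] at key
        have k0 : ∃ m, ∀ a, Ar.le (Ar.succ a) (Ar.zero : M) → Ar.le (Ar.succ a) (t.mval v) →
            φ'.mval (update (update v x a) b m) :=
          ⟨v 0, fun a ha => (hM.lt_le_false hN ha (hM.zero_le hN _)).elim⟩
        obtain ⟨m, hm⟩ := key k0 (by
          rintro c ⟨m, hm⟩
          by_cases hc : Ar.le (Ar.succ c) (t.mval v)
          · obtain ⟨m', hm'⟩ := (S M hM _).2.1 (h c hc)
            obtain ⟨k, hk1, hk2⟩ := hM.bound2 hN m m'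
            refine ⟨k, fun a ha hat => ?_⟩
            rw [hM.lt_succ hN, hM.le_iff hN] at ha
            obtain ha | rfl := ha
            · exact (S M hM _).1 _ _ hk1 (hm a ha hat)
            · exact (S M hM _).1 _ _ hk2 hm'
          · refine ⟨m, fun a ha hat => ?_⟩
            rw [hM.lt_succ hN, hM.le_iff hN] at ha
            obtain ha | rfl := ha
            · exact hm a ha hat
            · exact (hc hat).elim) (t.mval v)
        refine ⟨m, fun a ha => ?_⟩
        rw [update_comm hxb.symm]
        exact hm a ha ha
      · rintro ⟨m, h⟩ a ha
        have := h a ha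
        rw [update_comm hxb.symm] at this
        exact (S M hM _).2.2 ⟨m, this⟩

/-- Bounded versions in the standard model. -/
theorem Bdd.nat {φ φ' : Formula} {b : ℕ} (B : Bdd φ φ' b) (v : ℕ → ℕ) :
    (∀ m m', m ≤ m' → φ'.val (update v b m) → φ'.val (update v b m')) ∧
    (φ.val v ↔ ∃ m, φ'.val (update v b m)) := by
  obtain ⟨N, hN⟩ := B.sem.exists
  have := hN ℕ (isMdl_nat N) v
  simp only [Formula.mval_nat] at this
  exact this

end ModalArith


namespace ModalArith

open Function

variable {T : Set Formula}

theorem Term.val_numeral (n : ℕ) (v : ℕ → ℕ) : (Term.numeral n).val v = n := by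
  rw [← Term.mval_nat, Term.mval_numeral, num_nat]

/-! A Σ₁ definition of the graph of the diagonal function -/

def numcode (n : ℕ) : ℕ := (Term.numeral n).code

theorem numcode_zero : numcode 0 = Nat.pair 1 0 := rfl

theorem numcode_succ (n : ℕ) : numcode (n + 1) = Nat.pair 2 (numcode n) := rfl

/-- `u = pair s t`. -/
def fPair (s t u : Term) : Formula :=
  .or (.and (.lt s t) (.eq u (.add (.mul t t) s)))
    (.and (.le t s) (.eq u (.add (.add (.mul s s) s) t)))

theorem fPair_delta0 (s t u : Term) : IsDelta0 (fPair s t u) :=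
  .or (.and (.le _ _) (.eq _ _)) (.and (.le _ _) (.eq _ _))

theorem fPair_val (s t u : Term) (v : ℕ → ℕ) :
    (fPair s t u).val v ↔ u.val v = Nat.pair (s.val v) (t.val v) := by
  simp only [fPair, Formula.lt, Formula.val, Term.val, Nat.pair]
  split_ifs with h
  · exact ⟨fun h' => by rcases h' with h' | h' <;> omega, fun h' => Or.inl ⟨h, h'⟩⟩
  · exact ⟨fun h' => by rcases h' with h' | h' <;> omega, fun h' => Or.inr ⟨by omega, h'⟩⟩

theorem fPair_fv (s t u : Term) : (fPair s t u).fv = s.fv ∪ t.fv ∪ u.fv := by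
  ext y; simp [fPair, Formula.lt, Formula.fv, Term.fv]; tauto

def fBetaM (b i : Term) : Term := .succ (.mul (.succ i) b)

/-- `r = a mod ((i + 1) * b + 1)`, with auxiliary variable 20. -/
def fBeta (a b i r : Term) : Formula :=
  .and (.lt r (fBetaM b i)) (.ex 20 (.eq a (.add (.mul (fBetaM b i) (.var 20)) r)))

theorem fBeta_sigma1 (a b i r : Term) : IsSigma1 (fBeta a b i r) :=
  .and (.delta0 (.le _ _)) (.ex (.delta0 (.eq _ _)))

theorem fBeta_val (a b i r : Term) (ha : 20 ∉ a.fv) (hb : 20 ∉ b.fv) (hi : 20 ∉ i.fv)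
    (hr : 20 ∉ r.fv) (v : ℕ → ℕ) :
    (fBeta a b i r).val v ↔ r.val v = a.val v % ((i.val v + 1) * b.val v + 1) := by
  simp only [fBeta, fBetaM, Formula.lt, Formula.val, Term.val, a.val_upd 20 ha, b.val_upd 20 hb,
    i.val_upd 20 hi, r.val_upd 20 hr, update_self]
  obtain ⟨m, hm⟩ : ∃ m, m = (i.val v + 1) * b.val v + 1 := ⟨_, rfl⟩
  rw [← hm]
  constructor
  · rintro ⟨h1, q, h2⟩
    rw [h2, Nat.mul_add_mod, Nat.mod_eq_of_lt (by omega)]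
  · intro h
    rw [h]
    exact ⟨Nat.mod_lt _ (by omega), _, (Nat.div_add_mod _ _).symm⟩

theorem fBeta_fv (a b i r : Term) :
    (fBeta a b i r).fv ⊆ a.fv ∪ b.fv ∪ i.fv ∪ r.fv := by
  intro y; simp [fBeta, fBetaM, Formula.lt, Formula.fv, Term.fv]; tauto

/-- `x2 = numcode x1`. -/
def fNC : Formula :=
  .ex 3 (.ex 4 (.and (fBeta (.var 3) (.var 4) .zero (.numeral (Nat.pair 1 0)))
    (.and (fBeta (.var 3) (.var 4) (.var 1) (.var 2))
      (.ball 5 (.var 1) (.ex 6 (.ex 7 (.and (fBeta (.var 3) (.var 4) (.var 5) (.var 6))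
        (.and (fBeta (.var 3) (.var 4) (.succ (.var 5)) (.var 7))
          (fPair (.numeral 2) (.var 6) (.var 7))))))))))

theorem fNC_sigma1 : IsSigma1 fNC :=
  .ex (.ex (.and (fBeta_sigma1 _ _ _ _) (.and (fBeta_sigma1 _ _ _ _)
    (.ball (by simp [Term.fv]) (.ex (.ex (.and (fBeta_sigma1 _ _ _ _)
      (.and (fBeta_sigma1 _ _ _ _) (.delta0 (fPair_delta0 _ _ _))))))))))

theorem fNC_fv : fNC.fv ⊆ {1, 2} := by
  intro y
  simp [fNC, fBeta, fBetaM, fPair_fv, Formula.ball, Formula.lt, Formula.fv, Term.fv,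
    Term.fv_numeral]
  omega

theorem fNC_val (v : ℕ → ℕ) : fNC.val v ↔ v 2 = numcode (v 1) := by
  have e : fNC.val v ↔ ∃ a b : ℕ, (Nat.pair 1 0 = a % ((0 + 1) * b + 1)) ∧
      v 2 = a % ((v 1 + 1) * b + 1) ∧ ∀ i < v 1,
        a % ((i + 1 + 1) * b + 1) = Nat.pair 2 (a % ((i + 1) * b + 1)) := by
    simp [fNC, Formula.val, fBeta_val, Term.fv, Term.fv_numeral, val_ball, Term.val,
      Term.val_numeral, fPair_val, update_apply]
  rw [e]
  constructor
  · rintro ⟨a, b, h0, h1, h2⟩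
    have : ∀ i ≤ v 1, a % ((i + 1) * b + 1) = numcode i := by
      intro i
      induction i with
      | zero => intro _; rw [← h0]; rfl
      | succ i ih => intro hi; rw [h2 i (by omega), ih (by omega)]; rfl
    rw [h1, this _ le_rfl]
  · intro h
    let l : List ℕ := (List.range (v 1 + 1)).map numcode
    have hl : l.length = v 1 + 1 := by simp [l]
    have hb : ∀ i ≤ v 1, (Nat.unbeta l).unpair.1 % ((i + 1) * (Nat.unbeta l).unpair.2 + 1)
        = numcode i := by
      intro i hi
      have := Nat.beta_unbeta_coe l ⟨i, by omega⟩
      rw [Nat.beta] at this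
      simp only [] at this
      rw [this]
      simp [l]
    refine ⟨(Nat.unbeta l).unpair.1, (Nat.unbeta l).unpair.2, ?_, ?_, ?_⟩
    · rw [hb 0 (by omega)]; rfl
    · rw [hb _ le_rfl]; exact h
    · intro i hi
      rw [hb i (by omega), hb (i + 1) (by omega)]; rfl

/-- The instance `∃ x1 (x1 = n ∧ κ)`. -/
def inst (κ : Formula) (n : ℕ) : Formula := .ex 1 (.and (.eq (.var 1) (.numeral n)) κ)

/-- The code of `δ ∨ inst κ n` as a function of the codes. -/
def dfun (δ : Formula) (n c : ℕ) : ℕ :=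
  Nat.pair 4 (Nat.pair δ.code (Nat.pair 8 (Nat.pair 1 (Nat.pair 3
    (Nat.pair (Nat.pair 1 (Nat.pair (Nat.pair 0 1) (numcode n))) c)))))

theorem code_inst (δ κ : Formula) (n : ℕ) : (δ.or (inst κ n)).code = dfun δ n κ.code := rfl

/-- Graph of the diagonal function, input `x1`, output `x0`. -/
def fDiag (δ : Formula) (p q : ℕ) : Formula :=
  .ex 2 (.and fNC (.ex 8 (.ex 9 (.and (fPair (.var p) (.var q) (.var 1))
    (.ex 10 (.and (fPair (.numeral (Nat.pair 0 1)) (.var 2) (.var 10))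
    (.ex 11 (.and (fPair (.numeral 1) (.var 10) (.var 11))
    (.ex 12 (.and (fPair (.var 11) (.var 9) (.var 12))
    (.ex 13 (.and (fPair (.numeral 3) (.var 12) (.var 13))
    (.ex 14 (.and (fPair (.numeral 1) (.var 13) (.var 14))
    (.ex 15 (.and (fPair (.numeral 8) (.var 14) (.var 15))
    (.ex 16 (.and (fPair (.numeral δ.code) (.var 15) (.var 16))
      (fPair (.numeral 4) (.var 16) (.var 0))))))))))))))))))))

theorem fDiag_sigma1 (δ : Formula) (p q : ℕ) : IsSigma1 (fDiag δ p q) := by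
  have h := fun s t u => IsSigma1.delta0 (fPair_delta0 s t u)
  exact .ex (.and fNC_sigma1 (.ex (.ex (.and (h _ _ _) (.ex (.and (h _ _ _) (.ex (.and (h _ _ _)
    (.ex (.and (h _ _ _) (.ex (.and (h _ _ _) (.ex (.and (h _ _ _) (.ex (.and (h _ _ _)
    (.ex (.and (h _ _ _) (h _ _ _)))))))))))))))))))

theorem fDiag_fv (δ : Formula) (p q : ℕ) (hp : p = 8 ∨ p = 9) (hq : q = 8 ∨ q = 9) :
    (fDiag δ p q).fv ⊆ {0, 1} := by
  have h := fNC_fv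
  intro y
  have hy := @h y
  simp [fDiag, fPair_fv, Formula.fv, Term.fv, Term.fv_numeral] at hy ⊢
  grind

theorem fDiag_val1 (δ : Formula) (v : ℕ → ℕ) :
    (fDiag δ 9 8).val v ↔ v 0 = dfun δ (v 1) (v 1).unpair.1 := by
  simp [fDiag, Formula.val, fNC_val, fPair_val, Term.val, Term.val_numeral, update_apply]
  constructor
  · rintro ⟨a, b, h1, h2⟩
    rw [h1, Nat.unpair_pair, ← h1]; exact h2
  · intro h
    exact ⟨(v 1).unpair.2, (v 1).unpair.1, (Nat.pair_unpair _).symm, h⟩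

theorem fDiag_val2 (δ : Formula) (v : ℕ → ℕ) :
    (fDiag δ 8 9).val v ↔ v 0 = dfun δ (v 1) (v 1).unpair.2 := by
  simp [fDiag, Formula.val, fNC_val, fPair_val, Term.val, Term.val_numeral, update_apply]
  constructor
  · rintro ⟨a, b, h1, h2⟩
    rw [h1, Nat.unpair_pair, ← h1]; exact h2
  · intro h
    exact ⟨(v 1).unpair.1, (v 1).unpair.2, (Nat.pair_unpair _).symm, h⟩

/-! Representing `pr(F(x1))` -/

theorem IsMdl.delta0_congr {N : ℕ} {M : Type} [Ar M] (h : IsMdl N M) (hN : 5 ≤ N) {φ : Formula}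
    (hφ : IsDelta0 φ) (v : ℕ → M) (w : ℕ → ℕ) (e : ∀ x ∈ φ.fv, v x = num M (w x)) :
    φ.mval v ↔ φ.val w := by
  rw [← h.delta0 hN hφ, φ.mval_congr v _ e]

theorem exists_rep (F : ℕ → ℕ) (D : Formula) (hD : IsSigma1 D) (hfv : D.fv ⊆ {0, 1})
    (hval : ∀ v, D.val v ↔ v 0 = F (v 1)) (pr : Formula) (hpr : IsSigma1 pr)
    (hprfv : pr.fv ⊆ {0}) :
    ∃ R : Formula, IsSigma1 R ∧ R.fv ⊆ {1} ∧
      (∀ v : ℕ → ℕ, R.val v ↔ pr.val (update v 0 (F (v 1)))) ∧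
      (∀ᶠ N in Filter.atTop, ∀ (M : Type) [Ar M], IsMdl N M → ∀ (n : ℕ) (v : ℕ → M),
        v 1 = num M n → R.mval v → pr.mval (update v 0 (num M (F n)))) := by
  obtain ⟨b, hb⟩ : ∃ b, b = max D.bnd 2 := ⟨_, rfl⟩
  obtain ⟨D', B⟩ := exists_bdd hD b (by omega)
  have hfv' : ∀ y ∈ D'.fv, y = b ∨ y = 0 ∨ y = 1 := by
    intro y hy
    have := B.fv hy
    rw [Finset.mem_insert] at this
    rcases this with h | h
    · exact Or.inl h
    · have := hfv h; simp at this; exact Or.inr this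
  have h0t : 0 ∉ (Term.succ (.var b)).fv := by simp [Term.fv]; omega
  let K : Formula := .and (.eq (.var (b + 1)) (.var 0)) (.and (.le (.var (b + 1)) (.var b))
    (.and D' (.ball 0 (.succ (.var b)) (.imp D' (.eq (.var 0) (.var (b + 1)))))))
  have hK : IsDelta0 K := .and (.eq _ _) (.and (.le _ _) (.and B.delta0
    (.ball h0t (.imp B.delta0 (.eq _ _)))))
  let R : Formula := .ex 0 (.and (.ex b (.ex (b + 1) K)) pr)
  -- semantics of `R`
  have sem : ∀ (M : Type) [Ar M] (v : ℕ → M), R.mval v ↔ ∃ w : M, (∃ C : M, Ar.le w C ∧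
      D'.mval (update (update v 0 w) b C) ∧ ∀ a, Ar.le (Ar.succ a) (Ar.succ C) →
        D'.mval (update (update v 0 a) b C) → a = w) ∧ pr.mval (update v 0 w) := by
    intro M _ v
    have e1 : ∀ w C Z a : M, D'.mval (update (update (update (update v 0 w) b C) (b + 1) Z) 0 a) ↔
        D'.mval (update (update v 0 a) b C) := by
      intro w C Z a
      apply D'.mval_congr
      intro y hy
      rcases hfv' y hy with rfl | rfl | rfl
      · simp [update_apply]; omega
      · simp [update_apply]; omega
      · simp [update_apply]; omega
    have e2 : ∀ w C Z : M, D'.mval (update (update (update v 0 w) b C) (b + 1) Z) ↔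
        D'.mval (update (update v 0 w) b C) := by
      intro w C Z
      apply D'.mval_congr
      intro y hy
      rcases hfv' y hy with rfl | rfl | rfl
      · simp [update_apply]
      · simp [update_apply]
      · simp [update_apply]; omega
    simp only [R, K, Formula.mval, mval_ball h0t, Term.mval, e1, e2]
    have hb0 : (0 : ℕ) ≠ b := by omega
    have hb1 : (b + 1 : ℕ) ≠ 0 := by omega
    simp [update_apply, hb0]
  refine ⟨R, .ex (.and (.ex (.ex (.delta0 hK))) hpr), ?_, ?_, ?_⟩
  · intro y hy
    simp only [R, K, Formula.fv, Formula.ball, Formula.lt, Term.fv, Finset.mem_erase,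
      Finset.mem_union, Finset.mem_singleton] at hy ⊢
    have h1 := hfv' y
    have h2 := @hprfv y
    rw [Finset.mem_singleton] at h2
    grind
  · intro v
    rw [← Formula.mval_nat, sem ℕ v]
    simp only [Formula.mval_nat]
    have snd : ∀ w C : ℕ, D'.val (update (update v 0 w) b C) → w = F (v 1) := by
      intro w C h
      have := (hval _).1 ((B.nat (update v 0 w)).2.2 ⟨C, h⟩)
      simpa using this
    constructor
    · rintro ⟨w, ⟨C, _, h, _⟩, hp⟩
      rw [← snd w C h]; exact hp
    · intro hp
      obtain ⟨C, hC⟩ := (B.nat (update v 0 (F (v 1)))).2.1 ((hval _).2 (by simp))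
      refine ⟨F (v 1), ⟨C + F (v 1), ?_, ?_, ?_⟩, hp⟩
      · show F (v 1) ≤ C + F (v 1); omega
      · exact (B.nat _).1 _ _ (by omega) hC
      · intro a _ ha; exact snd a _ ha
  · filter_upwards [B.sem, Filter.eventually_ge_atTop 5] with N S hN M _ hM n v hv hR
    rw [sem] at hR
    obtain ⟨w, ⟨C, hwC, hD1, huniq⟩, hp⟩ := hR
    have ab : ∀ w' k : ℕ, D'.mval (update (update v 0 (num M w')) b (num M k)) ↔
        D'.val (update (update (fun _ => n) 0 w') b k) := by
      intro w' k
      apply hM.delta0_congr hN B.delta0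
      intro y hy
      by_cases hyb : y = b
      · subst hyb; simp
      · rcases hfv' y hy with rfl | rfl | rfl
        · exact (hyb rfl).elim
        · simp [update_apply, hyb]
        · simp [update_apply, hyb, hv]
    have snd : ∀ w C : ℕ, D'.val (update (update (fun _ => n) 0 w) b C) → w = F n := by
      intro w C h
      have := (hval _).1 ((B.nat (update (fun _ => n) 0 w)).2.2 ⟨C, h⟩)
      simpa using this
    obtain ⟨C0, hC0⟩ := (B.nat (update (fun _ => n) 0 (F n))).2.1 ((hval _).2 (by simp))
    have hC1 := (B.nat (update (fun _ => n) 0 (F n))).1 _ (C0 + F n) (by omega) hC0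
    rw [← ab] at hC1
    suffices w = num M (F n) by rw [← this]; exact hp
    obtain hlt | hle := hM.lt_or_le hN C (num M (C0 + F n))
    · obtain ⟨k, -, rfl⟩ := hM.lt_num hN _ _ hlt
      obtain ⟨w', -, rfl⟩ := hM.lt_num hN (k + 1) w ((hM.lt_succ hN).2 hwC)
      rw [ab] at hD1
      rw [snd _ _ hD1]
    · symm
      apply huniq
      · rw [hM.lt_succ hN]
        exact hM.le_trans hN ((hM.num_le hN _ _).2 (by omega)) hle
      · exact (S M hM _).1 _ _ hle hC1

end ModalArith


namespace ModalArith

open Function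

variable {T : Set Formula}

/-! Substitution of closed terms in Σ₁ formulas -/

def ClosedSub (s : ℕ → Term) : Prop := ∀ i, s i = .var i ∨ (s i).fv = ∅

theorem ClosedSub.upd {s : ℕ → Term} (h : ClosedSub s) (x : ℕ) :
    ClosedSub (update s x (.var x)) := by
  intro i
  by_cases hi : i = x
  · subst hi; simp
  · simpa [hi] using h i

theorem ClosedSub.notMem {s : ℕ → Term} (h : ClosedSub s) {x : ℕ} {t : Term} (hx : x ∉ t.fv) :
    x ∉ (t.substAll s).fv := by
  intro hm
  obtain ⟨y, hy, hxy⟩ := t.fv_substAll s x hm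
  rcases h y with e | e
  · rw [e] at hxy; simp [Term.fv] at hxy; subst hxy; exact hx hy
  · rw [e] at hxy; simp at hxy

theorem substAll_ball (x : ℕ) (t : Term) (φ : Formula) (s : ℕ → Term) :
    (Formula.ball x t φ).substAll s = .ball x (t.substAll (update s x (.var x)))
      (φ.substAll (update s x (.var x))) := by
  simp [Formula.ball, Formula.lt, Formula.substAll, Term.substAll]

theorem substAll_bex (x : ℕ) (t : Term) (φ : Formula) (s : ℕ → Term) :
    (Formula.bex x t φ).substAll s = .bex x (t.substAll (update s x (.var x)))
      (φ.substAll (update s x (.var x))) := by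
  simp [Formula.bex, Formula.lt, Formula.substAll, Term.substAll]

theorem IsDelta0.substAll {φ : Formula} (h : IsDelta0 φ) (s : ℕ → Term) (hs : ClosedSub s) :
    IsDelta0 (φ.substAll s) := by
  induction h generalizing s with
  | falsum => exact .falsum
  | eq t u => exact .eq _ _
  | le t u => exact .le _ _
  | and _ _ ih1 ih2 => exact .and (ih1 s hs) (ih2 s hs)
  | or _ _ ih1 ih2 => exact .or (ih1 s hs) (ih2 s hs)
  | imp _ _ ih1 ih2 => exact .imp (ih1 s hs) (ih2 s hs)
  | neg _ ih => exact .neg (ih s hs)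
  | ball hx _ ih => rw [substAll_ball]; exact .ball ((hs.upd _).notMem hx) (ih _ (hs.upd _))
  | bex hx _ ih => rw [substAll_bex]; exact .bex ((hs.upd _).notMem hx) (ih _ (hs.upd _))

theorem IsSigma1.substAll {φ : Formula} (h : IsSigma1 φ) (s : ℕ → Term) (hs : ClosedSub s) :
    IsSigma1 (φ.substAll s) := by
  induction h generalizing s with
  | delta0 hd => exact .delta0 (hd.substAll s hs)
  | and _ _ ih1 ih2 => exact .and (ih1 s hs) (ih2 s hs)
  | or _ _ ih1 ih2 => exact .or (ih1 s hs) (ih2 s hs)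
  | ex _ ih => exact .ex (ih _ (hs.upd _))
  | ball hx _ ih => rw [substAll_ball]; exact .ball ((hs.upd _).notMem hx) (ih _ (hs.upd _))

/-! Facts on `P.app` -/

theorem ProvPred.app_sigma1 (P : ProvPred T) (φ : Formula) : IsSigma1 (P.app φ) := by
  apply P.sigma1.substAll
  intro i
  by_cases hi : i = 0
  · subst hi; right; simp [Term.fv_numeral]
  · left; simp [hi]

theorem ProvPred.app_fv (P : ProvPred T) (φ : Formula) : (P.app φ).fv = ∅ := by
  apply Finset.eq_empty_of_forall_notMem
  intro y hy
  obtain ⟨x, hx, hxy⟩ := Formula.fv_substAll _ _ y hy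
  have := P.fvSub hx
  simp at this
  subst this
  simp [Term.fv_numeral] at hxy

theorem ProvPred.app_mval (P : ProvPred T) (φ : Formula) {M : Type} [Ar M] (v : ℕ → M) :
    (P.app φ).mval v ↔ P.pr.mval (update v 0 (num M φ.code)) := by
  rw [ProvPred.app, Formula.mval_subst _ _ _ _ (Formula.freeFor_closed _ _ _ (Term.fv_numeral _)),
    Term.mval_numeral]

theorem ProvPred.app_val (P : ProvPred T) (φ : Formula) (v : ℕ → ℕ) :
    P.pr.val (update v 0 φ.code) ↔ Provable T φ := by
  rw [← P.numerates φ, StdTrue, ← Formula.mval_nat]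
  have := P.app_mval φ (fun _ => (0 : ℕ))
  rw [num_nat] at this
  rw [ProvPred.app, Formula.mval_nat] at this
  rw [this]
  apply Formula.mval_congr
  intro x hx
  have := P.fvSub hx
  simp at this
  subst this
  simp

theorem mval_sentence {φ : Formula} (h : φ.fv = ∅) {M : Type} [Ar M] (v w : ℕ → M) :
    φ.mval v ↔ φ.mval w := φ.mval_congr v w (by simp [h])

/-- Rosser-style diagonal formulas. -/
theorem exists_repP (P : ProvPred T) (F : ℕ → ℕ) (D : Formula) (hD : IsSigma1 D)
    (hfv : D.fv ⊆ {0, 1}) (hval : ∀ v, D.val v ↔ v 0 = F (v 1)) :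
    ∃ R : Formula, IsSigma1 R ∧ R.fv ⊆ {1} ∧
      (∀ (v : ℕ → ℕ) (χ : Formula), χ.code = F (v 1) → (R.val v ↔ Provable T χ)) ∧
      (∀ᶠ N in Filter.atTop, ∀ (M : Type) [Ar M], IsMdl N M → ∀ (n : ℕ) (v : ℕ → M) (χ : Formula),
        χ.code = F n → v 1 = num M n → R.mval v → (P.app χ).mval v) := by
  obtain ⟨R, h1, h2, h3, h4⟩ := exists_rep F D hD hfv hval P.pr P.sigma1 P.fvSub
  refine ⟨R, h1, h2, ?_, ?_⟩
  · intro v χ hχ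
    rw [h3, ← hχ, P.app_val]
  · filter_upwards [h4] with N h M _ hM n v χ hχ hv hR
    rw [P.app_mval, hχ]
    exact h M hM n v hv hR

theorem inst_mval (κ : Formula) (n : ℕ) {M : Type} [Ar M] (v : ℕ → M) :
    (inst κ n).mval v ↔ κ.mval (update v 1 (num M n)) := by
  simp [inst, Formula.mval, Term.mval, Term.mval_numeral]

theorem inst_val (κ : Formula) (n : ℕ) (v : ℕ → ℕ) :
    (inst κ n).val v ↔ κ.val (update v 1 n) := by
  simp [inst, Formula.val, Term.val, Term.val_numeral]

theorem inst_fv (κ : Formula) (n : ℕ) (h : κ.fv ⊆ {1}) : (inst κ n).fv = ∅ := by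
  apply Finset.eq_empty_of_forall_notMem
  intro y hy
  simp [inst, Formula.fv, Term.fv, Term.fv_numeral] at hy
  obtain ⟨h1, h2⟩ := hy
  have := h h2; simp at this; exact h1 this

theorem inst_sigma1 {κ : Formula} (h : IsSigma1 κ) (n : ℕ) : IsSigma1 (inst κ n) :=
  .ex (.and (.delta0 (.eq _ _)) h)

theorem upd_const (n b k : ℕ) : update (fun _ => n) b k = fun i => if i = b then k else n := by
  funext i; simp [update_apply]

theorem dc_to_dp (hT : Extends T PAK) (P : ProvPred T) (h : DC T P IsSigmaB) :
    HasDP2 T IsSigmaB IsSigma1 := by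
  intro φ ψ hφ hψ sφ sψ hor
  obtain ⟨R, hR, Rfv, Rval, Rm⟩ := exists_repP P (fun m => dfun φ m m.unpair.1) (fDiag φ 9 8)
    (fDiag_sigma1 _ _ _) (fDiag_fv _ _ _ (by simp) (by simp)) (fDiag_val1 φ)
  obtain ⟨b, hb⟩ : ∃ b, b = max (max ψ.bnd R.bnd) 2 := ⟨_, rfl⟩
  obtain ⟨ψ', B1⟩ := exists_bdd hψ b (by omega)
  obtain ⟨R', B2⟩ := exists_bdd hR b (by omega)
  have fv1 : ∀ y ∈ ψ'.fv, y = b := by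
    intro y hy
    have := B1.fv hy
    rw [show ψ.fv = ∅ from sψ] at this
    simpa using this
  have fv2 : ∀ y ∈ R'.fv, y = b ∨ y = 1 := by
    intro y hy
    have := B2.fv hy
    rw [Finset.mem_insert] at this
    refine this.imp id fun h => ?_
    simpa using Rfv h
  let κ : Formula := .ex b (ψ'.and R'.neg)
  have hκ : IsSigma1 κ := .ex (.delta0 (.and B1.delta0 (.neg B2.delta0)))
  have κfv : κ.fv ⊆ {1} := by
    intro y hy
    simp only [κ, Formula.fv, Finset.mem_erase, Finset.mem_union, Finset.mem_singleton] at hy ⊢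
    have := fv1 y; have := fv2 y
    tauto
  obtain ⟨n, hn⟩ : ∃ n, n = Nat.pair κ.code 0 := ⟨_, rfl⟩
  let χ : Formula := φ.or (inst κ n)
  have hχc : χ.code = dfun φ n n.unpair.1 := by
    rw [show n.unpair.1 = κ.code by rw [hn, Nat.unpair_pair]]; exact code_inst _ _ _
  have hinst : (inst κ n).fv = ∅ := inst_fv κ n κfv
  have hχB : IsSigmaB χ := .or hφ (.sigma1 (inst_sigma1 hκ n))
  have hχs : Sentence χ := by
    show φ.fv ∪ (inst κ n).fv = ∅
    rw [hinst, show φ.fv = ∅ from sφ]; rfl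
  have step1 : Provable T (ψ.imp ((inst κ n).or (P.app χ))) := by
    apply complete hT
    · exact ⟨hψ.noBox, (inst_sigma1 hκ n).noBox, (P.app_sigma1 χ).noBox⟩
    · simp [Formula.fv, hinst, P.app_fv, show ψ.fv = ∅ from sψ]
    · filter_upwards [B1.sem, B2.sem, Rm] with N S1 S2 S3 M _ hM v hv
      rw [mval_sentence sψ v (update v 1 (num M n)), (S1 M hM _).2] at hv
      obtain ⟨m, hm⟩ := hv
      by_cases hr : R'.mval (update (update v 1 (num M n)) b m)
      · right
        have := S3 M hM n _ χ hχc (by simp) ((S2 M hM _).2.2 ⟨m, hr⟩)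
        exact (mval_sentence (P.app_fv χ) _ _).1 this
      · left
        rw [inst_mval]
        exact ⟨m, hm, hr⟩
  have hχ : Provable T χ := by
    apply h χ hχB hχs
    apply Der.toProv
    refine .mp (.mp (.mp (.lg (.orE φ ψ _)) ?_) ?_) (.thm hor)
    · exact .ded (.mp (.lg (.orI1 _ _)) (.mp (.lg (.orI1 _ _)) .h0))
    · refine .ded (.mp (.mp (.mp (.lg (.orE (inst κ n) (P.app χ) _)) ?_) ?_)
        (.mp (.thm step1) .h0))
      · exact .ded (.mp (.lg (.orI1 _ _)) (.mp (.lg (.orI2 _ _)) .h0))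
      · exact .lg (.orI2 _ _)
  have hRt : R.val (fun _ => n) := (Rval (fun _ => n) χ hχc).2 hχ
  by_cases hψt : ψ.val (fun _ => n)
  · exact Or.inr (sigma1_complete hT hψ sψ _ hψt)
  left
  obtain ⟨k, hk⟩ := (B2.nat _).2.1 hRt
  have step2 : Provable T (inst κ n).neg := by
    apply complete hT
    · exact (inst_sigma1 hκ n).noBox
    · exact hinst
    · filter_upwards [B1.sem, B2.sem, Filter.eventually_ge_atTop 5] with N S1 S2 hN M _ hM v hv
      rw [inst_mval] at hv
      obtain ⟨c, hc1, hc2⟩ := hv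
      obtain hlt | hle := hM.lt_or_le hN c (num M k)
      · obtain ⟨j, -, rfl⟩ := hM.lt_num hN _ _ hlt
        rw [hM.delta0_congr hN B1.delta0 _ (update (fun _ => n) b j) (by
          intro x hx; rw [fv1 x hx]; simp)] at hc1
        exact hψt ((B1.nat _).2.2 ⟨j, hc1⟩)
      · apply hc2
        apply (S2 M hM _).1 _ _ hle
        rw [hM.delta0_congr hN B2.delta0 _ (update (fun _ => n) b k) (by
          intro x hx
          by_cases hxb : x = b
          · subst hxb; simp
          · obtain rfl : x = 1 := (fv2 x hx).resolve_left hxb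
            simp [update_apply, hxb])]
        exact hk
  apply Der.toProv
  exact .mp (.mp (.mp (.lg (.orE φ (inst κ n) _)) (.id _)) (.mp (.lg (.negE _ _)) (.thm step2)))
    (.thm hχ)

theorem dp_to_dc (hT : Extends T PAK) (P : ProvPred T) (h : HasDP2 T IsSigmaB IsSigma1) :
    DC T P IsSigmaB := by
  intro φ hφ sφ hor
  rcases h φ (P.app φ) hφ (P.app_sigma1 φ) sφ (P.app_fv φ) hor with h1 | h1
  · exact h1
  obtain ⟨σ, hσd⟩ : ∃ σ, σ = P.app φ := ⟨_, rfl⟩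
  have sσ : σ.fv = ∅ := hσd ▸ P.app_fv φ
  have hσ : IsSigma1 σ := hσd ▸ P.app_sigma1 φ
  rw [← hσd] at h1
  by_cases hσt : σ.val (fun _ => 0)
  · rw [hσd, ← Formula.mval_nat, P.app_mval, num_nat, Formula.mval_nat, P.app_val] at hσt
    exact hσt
  obtain ⟨A1, hA1, A1fv, A1val, -⟩ := exists_repP P (fun m => dfun .falsum m m.unpair.1)
    (fDiag .falsum 9 8) (fDiag_sigma1 _ _ _) (fDiag_fv _ _ _ (by simp) (by simp))
    (fDiag_val1 .falsum)
  obtain ⟨A2, hA2, A2fv, A2val, -⟩ := exists_repP P (fun m => dfun .falsum m m.unpair.2)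
    (fDiag .falsum 8 9) (fDiag_sigma1 _ _ _) (fDiag_fv _ _ _ (by simp) (by simp))
    (fDiag_val2 .falsum)
  have hσA : IsSigma1 (σ.or A2) := .or hσ hA2
  have σAfv : (σ.or A2).fv ⊆ {1} := by
    simp only [Formula.fv, sσ, Finset.empty_union]; exact A2fv
  obtain ⟨b, hb⟩ : ∃ b, b = max (max (σ.or A2).bnd A1.bnd) 2 := ⟨_, rfl⟩
  obtain ⟨E, B1⟩ := exists_bdd hσA b (by omega)
  obtain ⟨A, B2⟩ := exists_bdd hA1 b (by omega)
  have fvg : ∀ {X X' : Formula}, X.fv ⊆ {1} → Bdd X X' b → ∀ y ∈ X'.fv, y = b ∨ y = 1 := by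
    intro X X' hX B y hy
    have := B.fv hy
    rw [Finset.mem_insert] at this
    refine this.imp id fun h => ?_
    simpa using hX h
  have fv1 := fvg σAfv B1
  have fv2 := fvg A1fv B2
  let w : ℕ := b + 1
  have hbw : b ∉ (Term.var w).fv := by simp [Term.fv, w]
  have hwb : w ≠ b := by simp [w]
  have hwE : w ∉ E.fv := fun h => by rcases fv1 w h with h | h <;> omega
  have hwA : w ∉ A.fv := fun h => by rcases fv2 w h with h | h <;> omega
  let θ1 : Formula := .ex w (.and (.ex b (.and (.eq (.var b) (.var w)) E)) (.ball b (.var w) A.neg))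
  let θ2 : Formula := .ex b (A.and E.neg)
  have hθ1 : IsSigma1 θ1 := .ex (.and (.ex (.delta0 (.and (.eq _ _) B1.delta0)))
    (.delta0 (.ball hbw (.neg B2.delta0))))
  have hθ2 : IsSigma1 θ2 := .ex (.delta0 (.and B2.delta0 (.neg B1.delta0)))
  have θ1fv : θ1.fv ⊆ {1} := by
    intro y hy
    simp only [θ1, Formula.fv, Formula.ball, Formula.lt, Term.fv, Finset.mem_erase,
      Finset.mem_union, Finset.mem_singleton] at hy ⊢
    have := fv1 y; have := fv2 y
    tauto
  have θ2fv : θ2.fv ⊆ {1} := by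
    intro y hy
    simp only [θ2, Formula.fv, Finset.mem_erase, Finset.mem_union, Finset.mem_singleton] at hy ⊢
    have := fv1 y; have := fv2 y
    tauto
  have θ1m : ∀ (M : Type) [Ar M] (v : ℕ → M), θ1.mval v ↔ ∃ c, E.mval (update v b c) ∧
      ∀ d, Ar.le (Ar.succ d) c → ¬ A.mval (update v b d) := by
    intro M _ v
    have e1 : ∀ c d : M, E.mval (update (update v w c) b d) ↔ E.mval (update v b d) := by
      intro c d; rw [update_comm hwb, E.mval_upd w hwE]
    have e2 : ∀ c d : M, A.mval (update (update v w c) b d) ↔ A.mval (update v b d) := by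
      intro c d; rw [update_comm hwb, A.mval_upd w hwA]
    simp only [θ1, Formula.mval, mval_ball hbw, Term.mval, e1, e2, update_self,
      update_of_ne hwb, exists_eq_left]
  have θ2m : ∀ (M : Type) [Ar M] (v : ℕ → M), θ2.mval v ↔ ∃ c, A.mval (update v b c) ∧
      ¬ E.mval (update v b c) := fun M _ v => Iff.rfl
  -- existence and disjointness in models
  have exi : ∀ᶠ N in Filter.atTop, ∀ (M : Type) [Ar M], IsMdl N M → ∀ (v : ℕ → M) (m : M),
      E.mval (update v b m) → θ1.mval v ∨ θ2.mval v := by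
    filter_upwards [Filter.eventually_ge_atTop 5, Filter.eventually_gt_atTop w,
      Filter.eventually_ge_atTop E.bnd] with N hN hNw hNE M _ hM v m hm
    by_contra hc
    rw [not_or, θ1m, θ2m] at hc
    obtain ⟨hc1, hc2⟩ := hc
    have key := hM.ind (.ball b (.var w) E.neg)
      (by simp [Formula.noBox, Formula.ball, Formula.lt, B1.delta0.noBox])
      (by simp [Formula.ball, Formula.lt, Formula.bnd, Term.bnd]; omega) w hNw v
    have e : ∀ c : M, (Formula.ball b (.var w) E.neg).mval (update v w c) ↔
        ∀ d, Ar.le (Ar.succ d) c → ¬ E.mval (update v b d) := by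
      intro c
      simp only [mval_ball hbw, Formula.mval, Term.mval, update_self]
      refine forall_congr' fun d => ?_
      rw [update_comm hwb, E.mval_upd w hwE]
    simp only [e] at key
    refine key (fun d hd => (hM.lt_le_false hN hd (hM.zero_le hN _)).elim) ?_ (Ar.succ m) m
      (hM.le_refl _) hm
    intro c hc d hd
    rw [hM.lt_succ hN, hM.le_iff hN] at hd
    obtain hd | rfl := hd
    · exact hc d hd
    · intro hE
      apply hc1
      refine ⟨d, hE, fun a ha hA => ?_⟩
      exact hc2 ⟨a, hA, hc a ha⟩
  have dis : ∀ᶠ N in Filter.atTop, ∀ (M : Type) [Ar M], IsMdl N M → ∀ (v : ℕ → M),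
      θ1.mval v → θ2.mval v → False := by
    filter_upwards [Filter.eventually_ge_atTop 5, B1.sem] with N hN S1 M _ hM v h1 h2
    rw [θ1m] at h1
    rw [θ2m] at h2
    obtain ⟨c, hc1, hc2⟩ := h1
    obtain ⟨d, hd1, hd2⟩ := h2
    obtain hlt | hle := hM.lt_or_le hN d c
    · exact hc2 d hlt hd1
    · exact hd2 ((S1 M hM v).1 _ _ hle hc1)
  obtain ⟨n, hn⟩ : ∃ n, n = Nat.pair θ1.code θ2.code := ⟨_, rfl⟩
  let χ1 : Formula := Formula.falsum.or (inst θ1 n)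
  let χ2 : Formula := Formula.falsum.or (inst θ2 n)
  have hχ1c : χ1.code = dfun .falsum n n.unpair.1 := by
    rw [show n.unpair.1 = θ1.code by rw [hn, Nat.unpair_pair]]; exact code_inst _ _ _
  have hχ2c : χ2.code = dfun .falsum n n.unpair.2 := by
    rw [show n.unpair.2 = θ2.code by rw [hn, Nat.unpair_pair]]; exact code_inst _ _ _
  have hχ1 : IsSigma1 χ1 := .or (.delta0 .falsum) (inst_sigma1 hθ1 n)
  have hχ2 : IsSigma1 χ2 := .or (.delta0 .falsum) (inst_sigma1 hθ2 n)
  have sχ1 : χ1.fv = ∅ := by simp [χ1, Formula.fv, inst_fv θ1 n θ1fv]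
  have sχ2 : χ2.fv = ∅ := by simp [χ2, Formula.fv, inst_fv θ2 n θ2fv]
  have χ1m : ∀ (M : Type) [Ar M] (v : ℕ → M), χ1.mval v ↔ θ1.mval (update v 1 (num M n)) := by
    intro M _ v; simp [χ1, Formula.mval, inst_mval]
  have χ2m : ∀ (M : Type) [Ar M] (v : ℕ → M), χ2.mval v ↔ θ2.mval (update v 1 (num M n)) := by
    intro M _ v; simp [χ2, Formula.mval, inst_mval]
  have step1 : Provable T (σ.imp (χ1.or χ2)) := by
    apply complete hT
    · exact ⟨hσ.noBox, hχ1.noBox, hχ2.noBox⟩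
    · simp [Formula.fv, sσ, sχ1, sχ2]
    · filter_upwards [exi, B1.sem] with N S S1 M _ hM v hv
      rw [mval_sentence sσ v (update v 1 (num M n))] at hv
      obtain ⟨m, hm⟩ := (S1 M hM _).2.1 (Or.inl hv)
      exact (S M hM _ m hm).imp (χ1m M v).2 (χ2m M v).2
  have step2 : Provable T (χ1.imp χ2.neg) := by
    apply complete hT
    · exact ⟨hχ1.noBox, hχ2.noBox⟩
    · simp [Formula.fv, sχ1, sχ2]
    · filter_upwards [dis] with N S M _ hM v h1 h2
      exact S M hM _ ((χ1m M v).1 h1) ((χ2m M v).1 h2)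
  have comp1 : θ1.mval (fun _ => n) → Provable T χ1 := fun ht => by
    refine sigma1_complete hT hχ1 sχ1 (fun _ => n) ?_
    rw [← Formula.mval_nat, χ1m, num_nat]
    simpa using ht
  have comp2 : θ2.mval (fun _ => n) → Provable T χ2 := fun ht => by
    refine sigma1_complete hT hχ2 sχ2 (fun _ => n) ?_
    rw [← Formula.mval_nat, χ2m, num_nat]
    simpa using ht
  have hA1t := A1val (fun _ => n) χ1 hχ1c
  have hA2t := A2val (fun _ => n) χ2 hχ2c
  have hσt' : ¬ σ.val (fun _ => n) := by
    rw [← Formula.mval_nat, mval_sentence sσ _ (fun _ => 0), Formula.mval_nat]; exact hσt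
  have imp12 : Provable T χ1 → Provable T χ2 := by
    intro hp
    obtain ⟨k, hk⟩ := (B2.nat _).2.1 (hA1t.2 hp)
    by_cases hE : E.val (update (fun _ => n) b k)
    · have := (B1.nat _).2.2 ⟨k, hE⟩
      exact hA2t.1 (this.resolve_left hσt')
    · apply comp2
      rw [θ2m]
      refine ⟨k, ?_⟩
      rw [Formula.mval_nat, Formula.mval_nat]
      exact ⟨hk, hE⟩
  have imp21 : Provable T χ2 → Provable T χ1 := by
    intro hp
    obtain ⟨k, hk⟩ := (B1.nat _).2.1 (Or.inr (hA2t.2 hp))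
    by_cases hA : A1.val (fun _ => n)
    · exact hA1t.1 hA
    · apply comp1
      rw [θ1m]
      refine ⟨k, (Formula.mval_nat _ _).2 hk, fun d _ hd => ?_⟩
      rw [Formula.mval_nat] at hd
      exact hA ((B2.nat _).2.2 ⟨d, hd⟩)
  have both : Provable T χ1 ∧ Provable T χ2 := by
    rcases h χ1 χ2 (.sigma1 hχ1) hχ2 sχ1 sχ2 (.mp step1 h1) with hp | hp
    · exact ⟨hp, imp12 hp⟩
    · exact ⟨imp21 hp, hp⟩
  exact .mp (.mp (.logic (.negE _ _)) (.mp step2 both.1)) both.2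

end ModalArith


namespace ModalArith

/-- For an r.e. extension T of PA(K) (with natural provability predicate P):
T has (ΣB, Σ₁)-DP iff T is ΣB-DC. -/
theorem statement15 (T : Set Formula) (hre : RE T) (hT : Extends T PAK)
    (P : ProvPred T) :
    HasDP2 T IsSigmaB IsSigma1 ↔ DC T P IsSigmaB :=
  ⟨dp_to_dc hT P, dc_to_dp hT P⟩

end ModalArith
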